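/- arXiv:2308.13455 — 3 statements merged into one kernel-verified Lean document; each statement's English description precedes it below -/
import Mathlib

section
/- Let 𝓗 be a hypergraph on a finite vertex set V, let α, p ∈ [0,1] and η ∈ (0,1], and write μ := μ_p(𝓗) and Δ := Δ_p(𝓗). Then Pr(ν(𝓗[V_p]) ≤ α·μ) ≤ exp(−(1 − α·log(e/α) − α·p − η)·μ + (1 + 2αp/η)·Δ), where for α = 0 the expression α·log(e/α) is interpreted as 0. -/
open MeasureTheory

noncomputable def bern (p : ℝ) : Measure Bool :=
  (ENNReal.ofReal p) • Measure.dirac true + (ENNReal.ofReal (1 - p)) • Measure.dirac false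

/-- The product Bernoulli measure on subsets of `V` (encoded as indicator functions):
the `p`-random subset `V_p`. -/
noncomputable def pBern (V : Type*) [Fintype V] (p : ℝ) : Measure (V → Bool) :=
  Measure.pi fun _ => bern p

/-- `μ_p(𝓗) = Σ_{A ∈ 𝓗} p^{|A|}`. -/
noncomputable def muP {V : Type*} (p : ℝ) (H : Finset (Finset V)) : ℝ :=
  ∑ A ∈ H, p ^ A.card

/-- `Δ_p(𝓗) = Σ p^{|A ∪ B|}` over unordered pairs of distinct intersecting hyperedges. -/
noncomputable def deltaP {V : Type*} [DecidableEq V] (p : ℝ) (H : Finset (Finset V)) : ℝ :=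
  (∑ A ∈ H, ∑ B ∈ H, if A ≠ B ∧ ¬ Disjoint A B then p ^ (A ∪ B).card else 0) / 2

/-- The matching number `ν(𝓗)`: the largest size of a collection of pairwise disjoint
hyperedges. -/
noncomputable def matchNum {V : Type*} (H : Finset (Finset V)) : ℕ :=
  sSup {k | ∃ M ⊆ H, (↑M : Set (Finset V)).Pairwise (fun A B => Disjoint A B) ∧ M.card = k}

/-- The subhypergraph `𝓗[W]` induced by the set encoded by `ω`. -/
def inducedBy {V : Type*} (H : Finset (Finset V)) (ω : V → Bool) : Finset (Finset V) :=
  H.filter fun A => ∀ v ∈ A, ω v = true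

section BernoulliExpectation

variable {V : Type*} [Fintype V] [DecidableEq V]

/-- The probability that the `p`-random subset of `V` equals `W`. -/
noncomputable def bernWeight (p : ℝ) (W : Finset V) : ℝ :=
  ∏ v, if v ∈ W then p else 1 - p

/-- The expectation of `f` at the `p`-random subset of `V`. -/
noncomputable def bernExp (p : ℝ) (f : Finset V → ℝ) : ℝ :=
  ∑ W, bernWeight p W * f W

lemma bernWeight_nonneg {p : ℝ} (hp : p ∈ Set.Icc (0 : ℝ) 1) (W : Finset V) :
    0 ≤ bernWeight p W := by
  refine Finset.prod_nonneg fun v _ => ?_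
  split_ifs
  · exact hp.1
  · linarith [hp.2]

lemma bernExp_mono {p : ℝ} (hp : p ∈ Set.Icc (0 : ℝ) 1) {f g : Finset V → ℝ}
    (h : ∀ W, f W ≤ g W) : bernExp p f ≤ bernExp p g :=
  Finset.sum_le_sum fun W _ => mul_le_mul_of_nonneg_left (h W) (bernWeight_nonneg hp W)

lemma bernExp_nonneg {p : ℝ} (hp : p ∈ Set.Icc (0 : ℝ) 1) {f : Finset V → ℝ}
    (h : ∀ W, 0 ≤ f W) : 0 ≤ bernExp p f :=
  Finset.sum_nonneg fun W _ => mul_nonneg (bernWeight_nonneg hp W) (h W)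

lemma bernExp_sub (p : ℝ) (f g : Finset V → ℝ) :
    bernExp p (fun W => f W - g W) = bernExp p f - bernExp p g := by
  simp [bernExp, mul_sub]

lemma bernExp_sum {ι : Type*} (p : ℝ) (s : Finset ι) (f : ι → Finset V → ℝ) :
    bernExp p (fun W => ∑ i ∈ s, f i W) = ∑ i ∈ s, bernExp p (f i) := by
  simp only [bernExp, Finset.mul_sum]
  exact Finset.sum_comm

lemma bernExp_one (p : ℝ) : bernExp p (fun _ : Finset V => 1) = 1 := by
  have h := Finset.prod_add (fun _ : V => p) (fun _ => 1 - p) Finset.univ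
  simp only [add_sub_cancel, Finset.prod_const_one, Finset.powerset_univ] at h
  refine Eq.trans (Finset.sum_congr rfl fun W _ => ?_) h.symm
  rw [mul_one, bernWeight, Finset.prod_ite]
  congr 2
  · ext; simp
  · ext; simp

lemma bernExp_ite_mem (p : ℝ) (v : V) (f : Finset V → ℝ) :
    bernExp p (fun W => if v ∈ W then f W else 0) = p * bernExp p (fun W => f (insert v W)) := by
  have hsplit : ∀ g : Finset V → ℝ, ∑ W, g W =
      ∑ W ∈ (Finset.univ.erase v).powerset, (g W + g (insert v W)) := by
    intro g
    rw [Finset.sum_add_distrib, ← Finset.sum_powerset_insert (Finset.notMem_erase v _),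
      Finset.insert_erase (Finset.mem_univ v), Finset.powerset_univ]
  rw [bernExp, bernExp, hsplit, hsplit, Finset.mul_sum]
  refine Finset.sum_congr rfl fun W hW => ?_
  have hv : v ∉ W := fun h => Finset.notMem_erase v _ (Finset.mem_powerset.1 hW h)
  have hr : ∏ x ∈ Finset.univ.erase v, (if x ∈ insert v W then p else 1 - p) =
      ∏ x ∈ Finset.univ.erase v, (if x ∈ W then p else 1 - p) := by
    refine Finset.prod_congr rfl fun x hx => ?_
    simp [Finset.ne_of_mem_erase hx]
  rw [bernWeight, bernWeight, ← Finset.mul_prod_erase _ _ (Finset.mem_univ v),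
    ← Finset.mul_prod_erase _ _ (Finset.mem_univ v), hr]
  simp only [hv, Finset.mem_insert_self, Finset.insert_idem, if_true, if_false]
  ring

lemma bernExp_ite_subset (p : ℝ) (C : Finset V) (f : Finset V → ℝ) :
    bernExp p (fun W => if C ⊆ W then f W else 0) =
      p ^ C.card * bernExp p (fun W => f (C ∪ W)) := by
  induction C using Finset.induction_on generalizing f with
  | empty => simp
  | insert v C hv ih =>
    have h1 : (fun W => if insert v C ⊆ W then f W else 0) =
        fun W => if v ∈ W then (if C ⊆ W then f W else 0) else 0 := by
      funext W
      simp only [Finset.insert_subset_iff, ite_and]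
    rw [h1, bernExp_ite_mem]
    simp only [Finset.subset_insert_iff_of_notMem hv]
    rw [ih (fun W => f (insert v W)), Finset.card_insert_of_notMem hv, pow_succ]
    simp only [Finset.insert_union]
    ring

end BernoulliExpectation

section Hypergraph

variable {V : Type*}

/-- The set `W` contains no hyperedge of `H`. -/
def Avoids (H : Finset (Finset V)) (W : Finset V) : Prop :=
  ∀ A ∈ H, ¬ A ⊆ W

lemma muP_nonneg {p : ℝ} (hp : 0 ≤ p) (H : Finset (Finset V)) : 0 ≤ muP p H :=
  Finset.sum_nonneg fun _ _ => pow_nonneg hp _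

lemma muP_mono {p : ℝ} (hp : 0 ≤ p) {G H : Finset (Finset V)} (h : G ⊆ H) :
    muP p G ≤ muP p H :=
  Finset.sum_le_sum_of_subset_of_nonneg h fun _ _ _ => pow_nonneg hp _

variable [DecidableEq V]

lemma deltaP_nonneg {p : ℝ} (hp : 0 ≤ p) (H : Finset (Finset V)) : 0 ≤ deltaP p H := by
  refine div_nonneg (Finset.sum_nonneg fun A _ => Finset.sum_nonneg fun B _ => ?_) zero_le_two
  split_ifs <;> positivity

lemma deltaP_mono {p : ℝ} (hp : 0 ≤ p) {G H : Finset (Finset V)} (h : G ⊆ H) :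
    deltaP p G ≤ deltaP p H := by
  have h0 : ∀ A B : Finset V,
      0 ≤ if A ≠ B ∧ ¬ Disjoint A B then p ^ (A ∪ B).card else 0 := by
    intro A B
    split_ifs <;> positivity
  refine div_le_div_of_nonneg_right ?_ zero_le_two
  refine (Finset.sum_le_sum fun A _ =>
    Finset.sum_le_sum_of_subset_of_nonneg h fun B _ _ => h0 A B).trans ?_
  exact Finset.sum_le_sum_of_subset_of_nonneg h fun A _ _ => Finset.sum_nonneg fun B _ => h0 A B

lemma deltaP_insert (p : ℝ) {A : Finset V} {H : Finset (Finset V)} (hA : A ∉ H) :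
    deltaP p (insert A H) =
      deltaP p H + ∑ B ∈ H with ¬ Disjoint A B, p ^ (A ∪ B).card := by
  have h1 : ∑ B ∈ H, (if A ≠ B ∧ ¬ Disjoint A B then p ^ (A ∪ B).card else 0) =
      ∑ B ∈ H with ¬ Disjoint A B, p ^ (A ∪ B).card := by
    rw [Finset.sum_filter]
    refine Finset.sum_congr rfl fun B hB => ?_
    have : A ≠ B := fun h => hA (h ▸ hB)
    simp [this]
  have h2 : ∑ B ∈ H, (if B ≠ A ∧ ¬ Disjoint B A then p ^ (B ∪ A).card else 0) =
      ∑ B ∈ H with ¬ Disjoint A B, p ^ (A ∪ B).card := by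
    rw [← h1]
    refine Finset.sum_congr rfl fun B _ => ?_
    simp only [ne_comm, disjoint_comm, Finset.union_comm]
  simp only [deltaP, Finset.sum_insert hA, Finset.sum_add_distrib]
  rw [h1, h2]
  simp only [ne_eq, not_true_eq_false, false_and, if_false]
  ring

variable [Fintype V]

open Classical in
/-- The **Janson inequality** for the lower tail at zero. -/
lemma bernExp_avoids_le {p : ℝ} (hp : p ∈ Set.Icc (0 : ℝ) 1) (H : Finset (Finset V)) :
    bernExp p (fun W => if Avoids H W then (1 : ℝ) else 0) ≤
      Real.exp (-muP p H + deltaP p H) := by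
  induction H using Finset.induction_on with
  | empty => simp [Avoids, muP, deltaP, bernExp_one]
  | insert A H hA ih =>
    set q : Finset (Finset V) → ℝ :=
      fun H => bernExp p (fun W => if Avoids H W then (1 : ℝ) else 0) with hq
    have hqmono : ∀ {G K : Finset (Finset V)}, G ⊆ K → q K ≤ q G := by
      intro G K h
      refine bernExp_mono hp fun W => ?_
      by_cases hK : Avoids K W
      · have hG : Avoids G W := fun B hB => hK B (h hB)
        simp [hK, hG]
      · rw [if_neg hK]; split_ifs <;> norm_num
    have hq0 : ∀ G, 0 ≤ q G := fun G => bernExp_nonneg hp fun W => by split_ifs <;> norm_num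
    set N := H.filter (fun B => ¬ Disjoint A B) with hN
    set F := H.filter (fun B => Disjoint A B) with hF
    set x : ℝ := p ^ A.card - ∑ B ∈ N, p ^ (A ∪ B).card with hx
    have hmu : -muP p (insert A H) + deltaP p (insert A H) =
        -x + (-muP p H + deltaP p H) := by
      rw [deltaP_insert p hA, muP, muP, Finset.sum_insert hA, hx]
      ring
    have hup : ∀ C, bernExp p (fun W => if C ⊆ W then (if Avoids F W then (1 : ℝ) else 0) else 0)
        ≤ p ^ C.card * q F := by
      intro C
      rw [bernExp_ite_subset]
      refine mul_le_mul_of_nonneg_left (bernExp_mono hp fun W => ?_) (pow_nonneg hp.1 _)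
      by_cases h : Avoids F (C ∪ W)
      · have h' : Avoids F W := fun B hB hBW => h B hB (hBW.trans Finset.subset_union_right)
        simp [h, h']
      · rw [if_neg h]; split_ifs <;> norm_num
    have heq : bernExp p (fun W => if A ⊆ W then (if Avoids F W then (1 : ℝ) else 0) else 0)
        = p ^ A.card * q F := by
      rw [bernExp_ite_subset]
      congr 2
      funext W
      have : Avoids F (A ∪ W) ↔ Avoids F W := by
        refine forall₂_congr fun B hB => not_congr ?_
        have hd : Disjoint A B := (Finset.mem_filter.1 hB).2
        exact ⟨fun h => hd.symm.left_le_of_le_sup_left h,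
          fun h => h.trans Finset.subset_union_right⟩
      simp [this]
    have hdiff : x * q F ≤ q H - q (insert A H) := by
      calc x * q F = p ^ A.card * q F - ∑ B ∈ N, p ^ (A ∪ B).card * q F := by
            rw [hx, sub_mul, Finset.sum_mul]
        _ ≤ bernExp p (fun W => if A ⊆ W then (if Avoids F W then (1 : ℝ) else 0) else 0) -
            ∑ B ∈ N, bernExp p
              (fun W => if A ∪ B ⊆ W then (if Avoids F W then (1 : ℝ) else 0) else 0) := by
            rw [heq]
            exact sub_le_sub_left (Finset.sum_le_sum fun B _ => hup _) _
        _ = bernExp p (fun W => (if A ⊆ W then (if Avoids F W then (1 : ℝ) else 0) else 0) -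
            ∑ B ∈ N, if A ∪ B ⊆ W then (if Avoids F W then (1 : ℝ) else 0) else 0) := by
            rw [bernExp_sub, bernExp_sum]
        _ ≤ bernExp p (fun W => (if Avoids H W then (1 : ℝ) else 0) -
            if Avoids (insert A H) W then (1 : ℝ) else 0) := by
            refine bernExp_mono hp fun W => ?_
            have hins : Avoids (insert A H) W ↔ ¬ A ⊆ W ∧ Avoids H W := by
              simp [Avoids]
            have hs0 : 0 ≤ ∑ B ∈ N,
                if A ∪ B ⊆ W then (if Avoids F W then (1 : ℝ) else 0) else 0 :=
              Finset.sum_nonneg fun B _ => by split_ifs <;> norm_num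
            by_cases hAW : A ⊆ W
            · by_cases hFW : Avoids F W
              · by_cases hHW : Avoids H W
                · simp only [hins, hAW, hFW, hHW, if_true, not_true_eq_false, false_and,
                    if_false] at hs0 ⊢
                  linarith
                · obtain ⟨B, hB, hBW⟩ : ∃ B ∈ H, B ⊆ W := by
                    simpa [Avoids] using hHW
                  have hBN : B ∈ N :=
                    Finset.mem_filter.2 ⟨hB, fun h => hFW B (Finset.mem_filter.2 ⟨hB, h⟩) hBW⟩
                  have := Finset.single_le_sum (s := N)
                    (f := fun B => if A ∪ B ⊆ W then (if Avoids F W then (1 : ℝ) else 0) else 0)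
                    (fun B _ => by split_ifs <;> norm_num) hBN
                  simp only [hFW, Finset.union_subset hAW hBW, if_true] at this
                  simp only [hins, hAW, hFW, hHW, if_true, not_true_eq_false, false_and,
                    if_false]
                  linarith
              · have hHW : ¬ Avoids H W := fun h =>
                  hFW fun B hB => h B (Finset.mem_filter.1 hB).1
                simp [hins, hFW, hHW]
            · simp only [hins, hAW, not_false_eq_true, true_and, if_false, sub_self]
              linarith
        _ = q H - q (insert A H) := bernExp_sub _ _ _
    rw [hmu, Real.exp_add]
    change q (insert A H) ≤ _
    refine le_trans ?_ (mul_le_mul_of_nonneg_left ih (Real.exp_pos _).le)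
    change _ ≤ Real.exp (-x) * q H
    rcases le_total 0 x with h0 | h0
    · have h1 : x * q H ≤ x * q F :=
        mul_le_mul_of_nonneg_left (hqmono (Finset.filter_subset _ _)) h0
      have h2 : (-x + 1) * q H ≤ Real.exp (-x) * q H :=
        mul_le_mul_of_nonneg_right (Real.add_one_le_exp _) (hq0 H)
      linarith
    · have h1 : q (insert A H) ≤ q H := hqmono (Finset.subset_insert _ _)
      have h2 : 1 ≤ Real.exp (-x) := Real.one_le_exp (by linarith)
      nlinarith [hq0 H]

end Hypergraph

section Matching

variable {V : Type*}

/-- Pairwise disjoint families of sets. -/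
def IsMatching (M : Finset (Finset V)) : Prop :=
  (↑M : Set (Finset V)).Pairwise fun A B => Disjoint A B

/-- Every matching in `H` all of whose hyperedges lie in `W` has at most `t` hyperedges. -/
def MatchingsLE (H : Finset (Finset V)) (t : ℝ) (W : Finset V) : Prop :=
  ∀ M ⊆ H, IsMatching M → (∀ A ∈ M, A ⊆ W) → (M.card : ℝ) ≤ t

lemma matchingsLE_of_matchNum_le [Fintype V] {H : Finset (Finset V)} {ω : V → Bool}
    {t : ℝ} (h : (matchNum (inducedBy H ω) : ℝ) ≤ t) :
    MatchingsLE H t (Finset.univ.filter fun v => ω v = true) := by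
  intro M hMH hM hMW
  have hbdd : BddAbove {k | ∃ M ⊆ inducedBy H ω,
      (↑M : Set (Finset V)).Pairwise (fun A B => Disjoint A B) ∧ M.card = k} := by
    refine ⟨(inducedBy H ω).card, ?_⟩
    rintro k ⟨M, hM, -, rfl⟩
    exact Finset.card_le_card hM
  have hsub : M ⊆ inducedBy H ω := fun A hA => by
    rw [inducedBy, Finset.mem_filter]
    exact ⟨hMH hA, fun v hv => (Finset.mem_filter.1 (hMW A hA hv)).2⟩
  have hle : M.card ≤ matchNum (inducedBy H ω) := le_csSup hbdd ⟨M, hsub, hM, rfl⟩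
  exact (Nat.cast_le.2 hle).trans h

variable [DecidableEq V]

/-- The expected number of hyperedges `B ≠ A` of `H` meeting `A` that are contained in the random
set, conditionally on `A` being contained in it. -/
noncomputable def condDegree (p : ℝ) (H : Finset (Finset V)) (A : Finset V) : ℝ :=
  ∑ B ∈ H, if A ≠ B ∧ ¬ Disjoint A B then p ^ (B \ A).card else 0

lemma condDegree_nonneg {p : ℝ} (hp : 0 ≤ p) (H : Finset (Finset V)) (A : Finset V) :
    0 ≤ condDegree p H A :=
  Finset.sum_nonneg fun B _ => by split_ifs <;> positivity

lemma condDegree_mono {p : ℝ} (hp : 0 ≤ p) {G H : Finset (Finset V)} (h : G ⊆ H)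
    (A : Finset V) : condDegree p G A ≤ condDegree p H A :=
  Finset.sum_le_sum_of_subset_of_nonneg h fun B _ _ => by split_ifs <;> positivity

lemma sum_pow_mul_condDegree (p : ℝ) (H : Finset (Finset V)) :
    ∑ A ∈ H, p ^ A.card * condDegree p H A = 2 * deltaP p H := by
  rw [deltaP, mul_div_cancel₀ _ two_ne_zero]
  refine Finset.sum_congr rfl fun A _ => ?_
  rw [condDegree, Finset.mul_sum]
  refine Finset.sum_congr rfl fun B _ => ?_
  rw [mul_ite, mul_zero, ← pow_add, add_comm, Finset.card_sdiff_add_card, Finset.union_comm]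

/-- The hyperedges of `G` disjoint from all members of `M`. -/
def edgesAwayFrom (G M : Finset (Finset V)) : Finset (Finset V) :=
  G.filter fun B => ∀ A ∈ M, Disjoint A B

lemma edgesAwayFrom_subset (G M : Finset (Finset V)) : edgesAwayFrom G M ⊆ G :=
  Finset.filter_subset _ _

lemma muP_edgesAwayFrom_ge {p : ℝ} (hp : p ∈ Set.Icc (0 : ℝ) 1) {G M : Finset (Finset V)}
    {D : ℝ} (hne : ∅ ∉ G) (hMG : M ⊆ G) (hD : ∀ A ∈ G, condDegree p G A ≤ D) :
    muP p G - M.card * (p + p * D) ≤ muP p (edgesAwayFrom G M) := by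
  have hpt : ∀ A ∈ M, ∑ B ∈ G, (if ¬ Disjoint A B then p ^ B.card else 0) ≤ p + p * D := by
    intro A hA
    have hAG := hMG hA
    have hA0 : A.Nonempty := Finset.nonempty_iff_ne_empty.2 fun h => hne (h ▸ hAG)
    calc ∑ B ∈ G, (if ¬ Disjoint A B then p ^ B.card else 0)
        ≤ ∑ B ∈ G, ((if A = B then p else 0) +
            p * if A ≠ B ∧ ¬ Disjoint A B then p ^ (B \ A).card else 0) := by
          refine Finset.sum_le_sum fun B hB => ?_
          by_cases hd : Disjoint A B
          · have : A ≠ B := by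
              rintro rfl
              exact hA0.ne_empty (Finset.disjoint_self_iff_empty _ |>.1 hd)
            simp [hd, this]
          · by_cases hAB : A = B
            · subst hAB
              simp only [hd, not_false_eq_true, if_true, ne_eq, not_true_eq_false, false_and,
                if_false, mul_zero, add_zero]
              exact pow_le_of_le_one hp.1 hp.2 hA0.card_pos.ne'
            · simp only [hd, hAB, not_false_eq_true, if_true, ne_eq, and_self, if_false, zero_add]
              rw [← pow_succ']
              refine pow_le_pow_of_le_one hp.1 hp.2 ?_
              refine Finset.card_lt_card (Finset.ssubset_iff_subset_ne.2 ⟨Finset.sdiff_subset, ?_⟩)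
              exact fun h => hd (Finset.sdiff_eq_self_iff_disjoint.1 h).symm
      _ = p + p * condDegree p G A := by
          rw [Finset.sum_add_distrib, ← Finset.mul_sum, Finset.sum_ite_eq, if_pos hAG, condDegree]
      _ ≤ p + p * D := by
          have := mul_le_mul_of_nonneg_left (hD A hAG) hp.1
          linarith
  have hsum : ∑ B ∈ G with ¬ ∀ A ∈ M, Disjoint A B, p ^ B.card ≤ M.card * (p + p * D) := by
    calc ∑ B ∈ G with ¬ ∀ A ∈ M, Disjoint A B, p ^ B.card
        ≤ ∑ B ∈ G, ∑ A ∈ M, (if ¬ Disjoint A B then p ^ B.card else 0) := by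
          rw [Finset.sum_filter]
          refine Finset.sum_le_sum fun B _ => ?_
          have h0 : ∀ A ∈ M, (0 : ℝ) ≤ if ¬ Disjoint A B then p ^ B.card else 0 := by
            intro A _
            have := pow_nonneg hp.1 B.card
            split_ifs <;> linarith
          by_cases h : ∀ A ∈ M, Disjoint A B
          · rw [if_neg (not_not.2 h)]
            exact Finset.sum_nonneg h0
          · rw [if_pos h]
            push Not at h
            obtain ⟨A, hA, hAB⟩ := h
            have := Finset.single_le_sum h0 hA
            rwa [if_pos hAB] at this
      _ = ∑ A ∈ M, ∑ B ∈ G, (if ¬ Disjoint A B then p ^ B.card else 0) := Finset.sum_comm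
      _ ≤ ∑ A ∈ M, (p + p * D) := Finset.sum_le_sum hpt
      _ = M.card * (p + p * D) := by rw [Finset.sum_const, nsmul_eq_mul]
  have := Finset.sum_filter_add_sum_filter_not G (fun B => ∀ A ∈ M, Disjoint A B)
    (fun B => p ^ B.card)
  simp only [muP, edgesAwayFrom]
  linarith

lemma exists_maximal_matching {G : Finset (Finset V)} {t : ℝ} {W : Finset V} (hne : ∅ ∉ G)
    (h : MatchingsLE G t W) :
    ∃ M ⊆ G, IsMatching M ∧ (M.card : ℝ) ≤ t ∧ M.biUnion id ⊆ W ∧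
      Avoids (edgesAwayFrom G M) W := by
  classical
  obtain ⟨M, hM, hmax⟩ := Finset.exists_max_image
    (G.powerset.filter fun M => IsMatching M ∧ ∀ A ∈ M, A ⊆ W) Finset.card
    ⟨∅, Finset.mem_filter.2 ⟨Finset.empty_mem_powerset G, by simp [IsMatching], by simp⟩⟩
  simp only [Finset.mem_filter, Finset.mem_powerset] at hM hmax
  obtain ⟨hMG, hMm, hMW⟩ := hM
  refine ⟨M, hMG, hMm, h M hMG hMm hMW, Finset.biUnion_subset.2 hMW, ?_⟩
  intro B hB hBW
  obtain ⟨hBG, hBd⟩ := Finset.mem_filter.1 hB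
  have hBM : B ∉ M := fun hBM =>
    hne ((Finset.disjoint_self_iff_empty B).1 (hBd B hBM) ▸ hBG)
  have := hmax (insert B M) ⟨Finset.insert_subset hBG hMG, ?_, ?_⟩
  · rw [Finset.card_insert_of_notMem hBM] at this
    omega
  · rw [IsMatching, Finset.coe_insert]
    exact Set.Pairwise.insert hMm fun A hA _ => ⟨(hBd A hA).symm, hBd A hA⟩
  · simpa [Finset.forall_mem_insert] using ⟨hBW, hMW⟩

/-- After deleting at most an `η`-proportion of the weight of `H`, all conditional degrees are at
most `2Δ / (ημ)`. -/
lemma exists_subset_condDegree_le {p η : ℝ} (hp : 0 ≤ p) (hη : 0 < η) {H : Finset (Finset V)}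
    (hμ : 0 < muP p H) :
    ∃ G ⊆ H, (1 - η) * muP p H ≤ muP p G ∧
      ∀ A ∈ G, condDegree p G A ≤ 2 * deltaP p H / (η * muP p H) := by
  set D := 2 * deltaP p H / (η * muP p H) with hD
  have hDμ : D * (η * muP p H) = 2 * deltaP p H := div_mul_cancel₀ _ (by positivity)
  have hD0 : 0 ≤ D := by
    have := deltaP_nonneg hp H
    positivity
  refine ⟨H.filter fun A => condDegree p H A ≤ D, Finset.filter_subset _ _, ?_, fun A hA =>
    (condDegree_mono hp (Finset.filter_subset _ _) A).trans (Finset.mem_filter.1 hA).2⟩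
  have h0 : ∀ A ∈ H, 0 ≤ p ^ A.card * condDegree p H A :=
    fun A _ => mul_nonneg (pow_nonneg hp _) (condDegree_nonneg hp H A)
  have hsum := sum_pow_mul_condDegree p H
  have hbad : ∑ A ∈ H with ¬ condDegree p H A ≤ D, p ^ A.card ≤ η * muP p H := by
    rcases hD0.eq_or_lt with h | h
    · rw [← hDμ, ← h, zero_mul, Finset.sum_eq_zero_iff_of_nonneg h0] at hsum
      rw [Finset.sum_eq_zero]
      · positivity
      · intro A hA
        obtain ⟨hAH, hAD⟩ := Finset.mem_filter.1 hA
        refine (mul_eq_zero.1 (hsum A hAH)).resolve_right fun h' => hAD ?_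
        rw [h']
        exact hD0
    · refine le_of_mul_le_mul_left ?_ h
      rw [hDμ, ← hsum, Finset.mul_sum]
      refine (Finset.sum_le_sum fun A hA => ?_).trans
        (Finset.sum_le_sum_of_subset_of_nonneg (Finset.filter_subset _ _) fun A hA _ => h0 A hA)
      rw [mul_comm]
      exact mul_le_mul_of_nonneg_left (not_le.1 (Finset.mem_filter.1 hA).2).le (pow_nonneg hp _)
  have := Finset.sum_filter_add_sum_filter_not H (fun A => condDegree p H A ≤ D)
    (fun A => p ^ A.card)
  simp only [muP] at hbad ⊢
  linarith

lemma MatchingsLE.erase_empty {H : Finset (Finset V)} {t : ℝ} {W : Finset V}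
    (h : MatchingsLE H t W) (hH : ∅ ∈ H) : MatchingsLE (H.erase ∅) (t - 1) W := by
  intro M hMH hM hMW
  have hM0 : ∅ ∉ M := fun h => Finset.notMem_erase _ _ (hMH h)
  have := h (insert ∅ M) (Finset.insert_subset hH (hMH.trans (Finset.erase_subset _ _))) ?_ ?_
  · rw [Finset.card_insert_of_notMem hM0] at this
    push_cast at this
    linarith
  · rw [IsMatching, Finset.coe_insert]
    exact Set.Pairwise.insert hM fun A _ _ =>
      ⟨Finset.disjoint_empty_left A, Finset.disjoint_empty_right A⟩
  · simpa [Finset.forall_mem_insert] using hMW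

lemma muP_erase_empty (p : ℝ) {H : Finset (Finset V)} (hH : ∅ ∈ H) :
    muP p (H.erase ∅) = muP p H - 1 := by
  have := Finset.add_sum_erase H (fun A => p ^ A.card) hH
  simp only [Finset.card_empty, pow_zero] at this
  simp only [muP]
  linarith

variable [Fintype V]

open Classical in
lemma bernExp_matchingsLE_le_of_condDegree_le {p : ℝ} (hp : p ∈ Set.Icc (0 : ℝ) 1)
    {G : Finset (Finset V)} {D t α : ℝ} (hne : ∅ ∉ G)
    (hD : ∀ A ∈ G, condDegree p G A ≤ D) (hD0 : 0 ≤ D) (hα : α ∈ Set.Icc (0 : ℝ) 1)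
    (hαt : α = 0 → t = 0) :
    bernExp p (fun W => if MatchingsLE G t W then (1 : ℝ) else 0) ≤
      α ^ (-t) * Real.exp (α * muP p G - muP p G + t * (p + p * D) + deltaP p G) := by
  set S := G.powerset.filter fun M => IsMatching M ∧ (M.card : ℝ) ≤ t with hS
  set c := Real.exp (-muP p G + t * (p + p * D) + deltaP p G) with hc
  have hpD : 0 ≤ p + p * D := add_nonneg hp.1 (mul_nonneg hp.1 hD0)
  have hαt0 : 0 ≤ α ^ (-t) := Real.rpow_nonneg hα.1 _
  have hunion : bernExp p (fun W => if MatchingsLE G t W then (1 : ℝ) else 0) ≤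
      ∑ M ∈ S, bernExp p (fun W => if M.biUnion id ⊆ W then
        (if Avoids (edgesAwayFrom G M) W then (1 : ℝ) else 0) else 0) := by
    rw [← bernExp_sum]
    refine bernExp_mono hp fun W => ?_
    have h0 : ∀ M ∈ S, (0 : ℝ) ≤ if M.biUnion id ⊆ W then
        (if Avoids (edgesAwayFrom G M) W then (1 : ℝ) else 0) else 0 :=
      fun M _ => by split_ifs <;> norm_num
    by_cases h : MatchingsLE G t W
    · obtain ⟨M, hMG, hMm, hMt, hMW, hav⟩ := exists_maximal_matching hne h
      have hMS : M ∈ S := Finset.mem_filter.2 ⟨Finset.mem_powerset.2 hMG, hMm, hMt⟩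
      have := Finset.single_le_sum h0 hMS
      rw [if_pos hMW, if_pos hav] at this
      rwa [if_pos h]
    · rw [if_neg h]
      exact Finset.sum_nonneg h0
  have hterm : ∀ M ∈ S, bernExp p (fun W => if M.biUnion id ⊆ W then
        (if Avoids (edgesAwayFrom G M) W then (1 : ℝ) else 0) else 0) ≤
      α ^ (-t) * c * ∏ A ∈ M, α * p ^ A.card := by
    intro M hM
    obtain ⟨hMG, hMm, hMt⟩ := Finset.mem_filter.1 hM
    rw [Finset.mem_powerset] at hMG
    have hcard : p ^ (M.biUnion id).card = ∏ A ∈ M, p ^ A.card := by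
      have h := Finset.card_biUnion (s := M) (t := id) hMm
      rw [h, Finset.prod_pow_eq_pow_sum]
      rfl
    have hprob : bernExp p (fun W => if Avoids (edgesAwayFrom G M)
        (M.biUnion id ∪ W) then (1 : ℝ) else 0) ≤ c := by
      refine le_trans (bernExp_mono hp fun W => ?_) ((bernExp_avoids_le hp
        (edgesAwayFrom G M)).trans (Real.exp_le_exp.2 ?_))
      · by_cases h : Avoids (edgesAwayFrom G M) (M.biUnion id ∪ W)
        · have h' : Avoids (edgesAwayFrom G M) W :=
            fun B hB hBW => h B hB (hBW.trans Finset.subset_union_right)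
          rw [if_pos h, if_pos h']
        · rw [if_neg h]; split_ifs <;> norm_num
      · have h1 := muP_edgesAwayFrom_ge hp hne hMG hD
        have h2 := deltaP_mono hp.1 (edgesAwayFrom_subset G M)
        have h3 := mul_le_mul_of_nonneg_right hMt hpD
        linarith
    have hα1 : 1 ≤ α ^ (-t) * α ^ M.card := by
      rcases hα.1.eq_or_lt with h | h
      · have ht := hαt h.symm
        have hM0 : M.card = 0 := by
          have : (M.card : ℝ) ≤ 0 := ht ▸ hMt
          exact_mod_cast le_antisymm this (Nat.cast_nonneg _)
        simp [ht, hM0]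
      · rw [← Real.rpow_natCast, ← Real.rpow_add h]
        exact Real.one_le_rpow_of_pos_of_le_one_of_nonpos h hα.2 (by linarith)
    rw [bernExp_ite_subset, hcard, Finset.prod_mul_distrib, Finset.prod_const]
    have hP : 0 ≤ ∏ A ∈ M, p ^ A.card := Finset.prod_nonneg fun A _ => pow_nonneg hp.1 _
    have hc0 : 0 ≤ c := (Real.exp_pos _).le
    calc _ ≤ (∏ A ∈ M, p ^ A.card) * c := mul_le_mul_of_nonneg_left hprob hP
      _ ≤ (α ^ (-t) * α ^ M.card) * ((∏ A ∈ M, p ^ A.card) * c) :=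
          le_mul_of_one_le_left (mul_nonneg hP hc0) hα1
      _ = _ := by ring
  have hprod : ∑ M ∈ S, ∏ A ∈ M, α * p ^ A.card ≤ Real.exp (α * muP p G) := by
    calc ∑ M ∈ S, ∏ A ∈ M, α * p ^ A.card
        ≤ ∑ M ∈ G.powerset, ∏ A ∈ M, α * p ^ A.card :=
          Finset.sum_le_sum_of_subset_of_nonneg (Finset.filter_subset _ _) fun M _ _ =>
            Finset.prod_nonneg fun A _ => mul_nonneg hα.1 (pow_nonneg hp.1 _)
      _ = ∏ A ∈ G, (1 + α * p ^ A.card) := (Finset.prod_one_add G).symm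
      _ ≤ ∏ A ∈ G, Real.exp (α * p ^ A.card) := by
          refine Finset.prod_le_prod (fun A _ => ?_) fun A _ => ?_
          · have := mul_nonneg hα.1 (pow_nonneg hp.1 A.card)
            linarith
          · rw [add_comm]
            exact Real.add_one_le_exp _
      _ = Real.exp (α * muP p G) := by rw [← Real.exp_sum, muP, Finset.mul_sum]
  calc _ ≤ _ := hunion
    _ ≤ ∑ M ∈ S, α ^ (-t) * c * ∏ A ∈ M, α * p ^ A.card := Finset.sum_le_sum hterm
    _ = α ^ (-t) * c * ∑ M ∈ S, ∏ A ∈ M, α * p ^ A.card := by rw [Finset.mul_sum]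
    _ ≤ α ^ (-t) * c * Real.exp (α * muP p G) :=
        mul_le_mul_of_nonneg_left hprod (mul_nonneg hαt0 (Real.exp_pos _).le)
    _ = _ := by
        rw [hc, mul_assoc, ← Real.exp_add]
        ring_nf

open Classical in
lemma bernExp_matchingsLE_le {p η t α : ℝ} (hp : p ∈ Set.Icc (0 : ℝ) 1) (hη : 0 < η)
    {H : Finset (Finset V)} (hne : ∅ ∉ H) (hα : α ∈ Set.Icc (0 : ℝ) 1) (ht0 : 0 ≤ t)
    (ht : t ≤ α * muP p H) :
    bernExp p (fun W => if MatchingsLE H t W then (1 : ℝ) else 0) ≤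
      α ^ (-t) * Real.exp (α * muP p H - (1 - η) * muP p H + t * p +
        (1 + 2 * α * p / η) * deltaP p H) := by
  have hΔ := deltaP_nonneg hp.1 H
  have hp0 := hp.1
  have hα0 := hα.1
  rcases (muP_nonneg hp.1 H).eq_or_lt with hμ | hμ
  · have ht1 : t = 0 := le_antisymm (by simpa [← hμ] using ht) ht0
    refine (bernExp_mono hp (g := fun _ => 1) fun W => by split_ifs <;> norm_num).trans ?_
    rw [bernExp_one, ht1, ← hμ, neg_zero, Real.rpow_zero, one_mul]
    refine Real.one_le_exp ?_
    have : 0 ≤ (1 + 2 * α * p / η) * deltaP p H := by positivity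
    linarith
  · obtain ⟨G, hGH, hGμ, hGD⟩ := exists_subset_condDegree_le hp.1 hη hμ
    set D := 2 * deltaP p H / (η * muP p H) with hD
    have hD0 : 0 ≤ D := by positivity
    have hmono : bernExp p (fun W => if MatchingsLE H t W then (1 : ℝ) else 0) ≤
        bernExp p (fun W => if MatchingsLE G t W then (1 : ℝ) else 0) := by
      refine bernExp_mono hp fun W => ?_
      by_cases h : MatchingsLE H t W
      · have h' : MatchingsLE G t W := fun M hM => h M (hM.trans hGH)
        rw [if_pos h, if_pos h']
      · rw [if_neg h]; split_ifs <;> norm_num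
    refine hmono.trans ((bernExp_matchingsLE_le_of_condDegree_le hp (fun h => hne (hGH h)) hGD hD0
      hα fun h => le_antisymm (by simpa [h] using ht) ht0).trans ?_)
    refine mul_le_mul_of_nonneg_left (Real.exp_le_exp.2 ?_) (Real.rpow_nonneg hα.1 _)
    have h1 : t * (p * D) ≤ 2 * α * p / η * deltaP p H := by
      calc t * (p * D) ≤ α * muP p H * (p * D) :=
            mul_le_mul_of_nonneg_right ht (mul_nonneg hp0 hD0)
        _ = 2 * α * p / η * deltaP p H := by
            rw [hD]
            field_simp
    have h2 := deltaP_mono hp.1 hGH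
    have h3 := mul_le_mul_of_nonneg_left (muP_mono hp.1 hGH) hα.1
    linarith

end Matching

section Measure

variable {V : Type*} [Fintype V] [DecidableEq V]

lemma bern_singleton (p : ℝ) (b : Bool) :
    bern p {b} = ENNReal.ofReal (if b = true then p else 1 - p) := by
  cases b <;> simp [bern]

instance bern_isFiniteMeasure (p : ℝ) : IsFiniteMeasure (bern p) := by
  refine ⟨?_⟩
  simp [bern]

open Classical in
lemma pBern_le_bernExp {p : ℝ} (hp : p ∈ Set.Icc (0 : ℝ) 1) {S : Set (V → Bool)}
    {Q : Finset V → Prop} (h : ∀ ω ∈ S, Q (Finset.univ.filter fun v => ω v = true)) :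
    pBern V p S ≤ ENNReal.ofReal (bernExp p fun W => if Q W then (1 : ℝ) else 0) := by
  have hsing : ∀ ω : V → Bool, pBern V p {ω} =
      ENNReal.ofReal (bernWeight p (Finset.univ.filter fun v => ω v = true)) := by
    intro ω
    rw [pBern, Measure.pi_singleton, bernWeight, ENNReal.ofReal_prod_of_nonneg]
    · refine Finset.prod_congr rfl fun v _ => ?_
      simp [bern_singleton]
    · intro v _
      split_ifs
      · exact hp.1
      · linarith [hp.2]
  have hS : pBern V p S = ∑ ω ∈ S.toFinset, pBern V p {ω} := by
    rw [MeasureTheory.sum_measure_singleton, Set.coe_toFinset]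
  have hinj : Function.Injective
      fun ω : V → Bool => Finset.univ.filter fun v => ω v = true := by
    intro ω ω' hω
    funext v
    have := Finset.ext_iff.1 hω v
    simp only [Finset.mem_filter, Finset.mem_univ, true_and] at this
    exact Bool.eq_iff_iff.2 this
  rw [hS, Finset.sum_congr rfl fun ω _ => hsing ω,
    ← ENNReal.ofReal_sum_of_nonneg fun ω _ => bernWeight_nonneg hp _]
  refine ENNReal.ofReal_le_ofReal ?_
  rw [← Finset.sum_image (f := bernWeight p)
    (g := fun ω : V → Bool => Finset.univ.filter fun v => ω v = true) hinj.injOn, bernExp]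
  simp only [mul_ite, mul_one, mul_zero]
  rw [← Finset.sum_filter]
  refine Finset.sum_le_sum_of_subset_of_nonneg ?_ fun W _ _ => bernWeight_nonneg hp W
  intro W hW
  obtain ⟨ω, hω, rfl⟩ := Finset.mem_image.1 hW
  exact Finset.mem_filter.2 ⟨Finset.mem_univ _, h ω (Set.mem_toFinset.1 hω)⟩

end Measure

lemma mul_log_exp_one_div {α : ℝ} (hα : 0 ≤ α) :
    α * Real.log (Real.exp 1 / α) = α - α * Real.log α := by
  rcases hα.eq_or_lt with h | h
  · simp [← h]
  · rw [Real.log_div (Real.exp_pos 1).ne' h.ne', Real.log_exp]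
    ring

theorem stmt2 {V : Type} [Fintype V] [DecidableEq V] (H : Finset (Finset V))
    (α η p : ℝ) (hα : α ∈ Set.Icc (0 : ℝ) 1) (hη : η ∈ Set.Ioc (0 : ℝ) 1)
    (hp : p ∈ Set.Icc (0 : ℝ) 1)
    (μ Δ : ℝ) (hμ : μ = muP p H) (hΔ : Δ = deltaP p H) :
    pBern V p {ω | (matchNum (inducedBy H ω) : ℝ) ≤ α * μ}
      ≤ ENNReal.ofReal
        (Real.exp (-(1 - α * Real.log (Real.exp 1 / α) - α * p - η) * μ
          + (1 + 2 * α * p / η) * Δ)) := by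
  classical
  have hp0 := hp.1
  have hα0 := hα.1
  have hη0 := hη.1
  have hμ0 : 0 ≤ μ := hμ ▸ muP_nonneg hp0 H
  rw [mul_log_exp_one_div hα0]
  by_cases hH : ∅ ∈ H
  · have hsmall : ∀ ω ∈ {ω | (matchNum (inducedBy H ω) : ℝ) ≤ α * μ},
        MatchingsLE (H.erase ∅) (α * μ - 1) (Finset.univ.filter fun v => ω v = true) :=
      fun ω hω => (matchingsLE_of_matchNum_le hω).erase_empty hH
    have hΔ' : deltaP p (H.erase ∅) ≤ Δ := hΔ ▸ deltaP_mono hp0 (Finset.erase_subset _ _)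
    have hμ' : muP p (H.erase ∅) = μ - 1 := by rw [muP_erase_empty p hH, hμ]
    rcases lt_or_ge (α * μ - 1) 0 with ht | ht
    · have hempty : {ω | (matchNum (inducedBy H ω) : ℝ) ≤ α * μ} = ∅ := by
        refine Set.eq_empty_of_forall_notMem fun ω hω => ?_
        have := hsmall ω hω ∅ (Finset.empty_subset _) (by simp [IsMatching]) (by simp)
        simp only [Finset.card_empty, Nat.cast_zero] at this
        linarith
      rw [hempty, measure_empty]
      exact zero_le
    · have hαpos : 0 < α := by
        refine hα0.lt_of_ne fun h => ?_
        rw [← h] at ht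
        linarith
      refine (pBern_le_bernExp hp hsmall).trans (ENNReal.ofReal_le_ofReal ?_)
      refine (bernExp_matchingsLE_le hp hη0 (Finset.notMem_erase _ _) hα ht ?_).trans ?_
      · rw [hμ']
        linarith [hα.2]
      rw [Real.rpow_def_of_pos hαpos, ← Real.exp_add, hμ']
      refine Real.exp_le_exp.2 ?_
      have h1 : Real.log α ≤ α - 1 := Real.log_le_sub_one_of_pos hαpos
      have h2 : (1 + 2 * α * p / η) * deltaP p (H.erase ∅) ≤ (1 + 2 * α * p / η) * Δ :=
        mul_le_mul_of_nonneg_left hΔ' (by positivity)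
      linarith
  · refine (pBern_le_bernExp hp fun ω hω => matchingsLE_of_matchNum_le hω).trans
      (ENNReal.ofReal_le_ofReal ?_)
    refine (bernExp_matchingsLE_le hp hη0 hH hα (mul_nonneg hα0 hμ0) (by rw [hμ])).trans ?_
    rw [← hμ, ← hΔ]
    rcases hα0.eq_or_lt with h | h
    · rw [← h]
      refine le_of_eq ?_
      simp only [zero_mul, neg_zero, Real.rpow_zero, one_mul, sub_zero]
      ring_nf
    · rw [Real.rpow_def_of_pos h, ← Real.exp_add]
      refine Real.exp_le_exp.2 (le_of_eq ?_)
      ring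
end

section
/- For every α > 0 and every positive integer ℓ there exists ρ > 0 such that the following holds for every positive integer n, every ℓ-uniform hypergraph 𝓗 on n vertices with at most ρ·n^ℓ hyperedges, and every p ∈ [0,1]: letting R := V(𝓗)_p be the p-random subset of the vertices, Pr(|𝓗[R]| ≥ α·(np)^ℓ) ≤ exp(−ρ·n·p). -/
open MeasureTheory

lemma isProbabilityMeasure_bern {p : ℝ} (hp : p ∈ Set.Icc (0 : ℝ) 1) :
    IsProbabilityMeasure (bern p) := by
  constructor
  simp only [bern, Measure.add_apply, Measure.smul_apply, measure_univ, smul_eq_mul, mul_one]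
  rw [← ENNReal.ofReal_add hp.1 (by linarith [hp.2])]
  simp

lemma isProbabilityMeasure_pBern (V : Type*) [Fintype V] {p : ℝ} (hp : p ∈ Set.Icc (0 : ℝ) 1) :
    IsProbabilityMeasure (pBern V p) := by
  have := isProbabilityMeasure_bern hp
  unfold pBern
  infer_instance

lemma bern_singleton_true (p : ℝ) : bern p {true} = ENNReal.ofReal p := by
  simp [bern]

/-- A fixed set `U` is contained in `V_p` with probability `p ^ |U|`. -/
lemma pBern_real_subset {V : Type*} [Fintype V] {p : ℝ} (hp : p ∈ Set.Icc (0 : ℝ) 1)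
    (U : Finset V) : (pBern V p).real {ω | ∀ v ∈ U, ω v = true} = p ^ U.card := by
  classical
  have := isProbabilityMeasure_bern hp
  have hset : {ω : V → Bool | ∀ v ∈ U, ω v = true}
      = Set.univ.pi fun v => if v ∈ U then {true} else Set.univ := by
    ext ω
    simp only [Set.mem_ofPred_eq, Set.mem_univ_pi]
    refine forall_congr' fun v => ?_
    by_cases hv : v ∈ U <;> simp [hv]
  have hfac (v : V) : bern p (if v ∈ U then {true} else Set.univ)
      = if v ∈ U then ENNReal.ofReal p else 1 := by
    split_ifs
    · exact bern_singleton_true p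
    · exact measure_univ
  rw [Measure.real, hset, pBern, Measure.pi_pi]
  simp only [hfac, Finset.prod_ite_mem, Finset.univ_inter, Finset.prod_const]
  rw [ENNReal.toReal_pow, ENNReal.toReal_ofReal hp.1]

lemma card_inducedBy_eq_sum {V : Type*} (H : Finset (Finset V)) (ω : V → Bool) :
    ((inducedBy H ω).card : ℝ)
      = ∑ A ∈ H, Set.indicator {ω : V → Bool | ∀ v ∈ A, ω v = true} (fun _ => (1 : ℝ)) ω := by
  classical
  simp [inducedBy, Set.indicator_apply]

lemma integral_indicator_subset_mul_card_pow_le {V : Type*} [Fintype V] [DecidableEq V] {p : ℝ}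
    (hp : p ∈ Set.Icc (0 : ℝ) 1) (H : Finset (Finset V)) (ℓ k : ℕ) (hH : ∀ A ∈ H, A.card = ℓ)
    {b : ℝ} (hb : 0 ≤ b)
    (hU : ∀ U : Finset V, U.card ≤ ℓ * k → ∑ A ∈ H, p ^ (A \ U).card ≤ b) (m : ℕ) :
    ∀ U : Finset V, U.card + ℓ * m ≤ ℓ * (k + 1) →
      ∫ ω, Set.indicator {ω : V → Bool | ∀ v ∈ U, ω v = true} (fun _ => (1 : ℝ)) ω
        * ((inducedBy H ω).card : ℝ) ^ m ∂(pBern V p) ≤ p ^ U.card * b ^ m := by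
  have := isProbabilityMeasure_pBern V hp
  induction m with
  | zero =>
    intro U _
    simp only [pow_zero, mul_one]
    rw [integral_indicator_const _ (Set.toFinite _).measurableSet, pBern_real_subset hp]
    simp
  | succ m ih =>
    intro U hcard
    have hpt (ω : V → Bool) :
        Set.indicator {ω : V → Bool | ∀ v ∈ U, ω v = true} (fun _ => (1 : ℝ)) ω
          * ((inducedBy H ω).card : ℝ) ^ (m + 1)
        = ∑ A ∈ H, Set.indicator {ω : V → Bool | ∀ v ∈ U ∪ A, ω v = true} (fun _ => (1 : ℝ)) ω
          * ((inducedBy H ω).card : ℝ) ^ m := by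
      rw [pow_succ', ← mul_assoc]
      nth_rw 1 [card_inducedBy_eq_sum]
      rw [Finset.mul_sum, Finset.sum_mul]
      refine Finset.sum_congr rfl fun A _ => ?_
      congr 1
      simp only [Set.indicator_apply, Set.mem_ofPred_eq, Finset.mem_union, or_imp, forall_and,
        ite_and, ite_mul, one_mul, zero_mul]
    simp only [hpt]
    rw [integral_finsetSum _ fun _ _ => Integrable.of_finite]
    calc _ ≤ ∑ A ∈ H, p ^ (U ∪ A).card * b ^ m := by
          refine Finset.sum_le_sum fun A hA => ih _ ?_
          have h₁ := Finset.card_union_le U A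
          rw [hH A hA] at h₁
          linarith [Nat.mul_succ ℓ m]
      _ = p ^ U.card * b ^ m * ∑ A ∈ H, p ^ (A \ U).card := by
          rw [Finset.mul_sum]
          refine Finset.sum_congr rfl fun A _ => ?_
          rw [← Finset.union_sdiff_self_eq_union, Finset.card_union_of_disjoint
            Finset.disjoint_sdiff, pow_add]
          ring
      _ ≤ p ^ U.card * b ^ m * b := by
          have hp0 := hp.1
          refine mul_le_mul_of_nonneg_left (hU U ?_) (by positivity)
          linarith [Nat.mul_succ ℓ m, Nat.mul_succ ℓ k, Nat.zero_le (ℓ * m)]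
      _ = p ^ U.card * b ^ (m + 1) := by ring

lemma sum_prod_powersetCard_succ_le {V : Type*} [Fintype V] [DecidableEq V] (w : V → ℝ)
    (hw : ∀ v, 0 ≤ w v) (U : Finset V) (k : ℕ) :
    ∑ A ∈ (Finset.powersetCard (k + 1) Finset.univ).filter (fun A => ¬ Disjoint A U),
        ∏ v ∈ A, w v
      ≤ (∑ u ∈ U, w u) * ∑ B ∈ Finset.powersetCard k Finset.univ, ∏ v ∈ B, w v := by
  rw [Finset.sum_mul_sum, ← Finset.sum_product']
  have hex : ∀ A ∈ (Finset.powersetCard (k + 1) Finset.univ).filter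
      (fun A => ¬ Disjoint A U), ∃ u, u ∈ A ∧ u ∈ U := fun A hA =>
    Finset.not_disjoint_iff.mp (Finset.mem_filter.mp hA).2
  rcases isEmpty_or_nonempty V with hV | hV
  · simp [Finset.eq_empty_of_isEmpty]
  choose! u huA huU using hex
  calc _ = ∑ A ∈ (Finset.powersetCard (k + 1) Finset.univ).filter (fun A => ¬ Disjoint A U),
          w (u A) * ∏ v ∈ A.erase (u A), w v :=
        Finset.sum_congr rfl fun A hA => (Finset.mul_prod_erase A w (huA A hA)).symm
    _ = ∑ x ∈ ((Finset.powersetCard (k + 1) Finset.univ).filter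
          (fun A => ¬ Disjoint A U)).image (fun A => (u A, A.erase (u A))),
          w x.1 * ∏ v ∈ x.2, w v := by
        rw [Finset.sum_image]
        intro A hA A' hA' h
        simp only [Prod.mk.injEq] at h
        rw [← Finset.insert_erase (huA A hA), ← Finset.insert_erase (huA A' hA'), h.2, h.1]
    _ ≤ _ := by
        refine Finset.sum_le_sum_of_subset_of_nonneg ?_ fun x _ _ =>
          mul_nonneg (hw _) (Finset.prod_nonneg fun v _ => hw v)
        intro x hx
        obtain ⟨A, hA, rfl⟩ := Finset.mem_image.mp hx
        have hcard : A.card = k + 1 := by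
          simpa [Finset.mem_powersetCard] using (Finset.mem_filter.mp hA).1
        simp [Finset.mem_powersetCard, huU A hA, Finset.card_erase_of_mem (huA A hA), hcard]

lemma sum_prod_powersetCard_le_pow {V : Type*} [Fintype V] [DecidableEq V] (w : V → ℝ)
    (hw : ∀ v, 0 ≤ w v) (k : ℕ) :
    ∑ A ∈ Finset.powersetCard k Finset.univ, ∏ v ∈ A, w v ≤ (∑ v, w v) ^ k := by
  induction k with
  | zero => simp
  | succ k ih =>
    have h := sum_prod_powersetCard_succ_le w hw Finset.univ k
    rw [Finset.filter_true_of_mem] at h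
    · rw [pow_succ']
      exact h.trans (mul_le_mul_of_nonneg_left ih (Finset.sum_nonneg fun v _ => hw v))
    · intro A hA
      have hcard : A.card = k + 1 := by simpa [Finset.mem_powersetCard] using hA
      obtain ⟨v, hv⟩ := Finset.card_pos.mp (by omega : 0 < A.card)
      exact Finset.not_disjoint_iff.mpr ⟨v, hv, Finset.mem_univ v⟩

lemma sum_pow_card_sdiff_le {V : Type*} [Fintype V] [DecidableEq V] {p : ℝ} (hp : 0 ≤ p)
    (H : Finset (Finset V)) (k : ℕ) (hH : ∀ A ∈ H, A.card = k + 1) (U : Finset V) :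
    ∑ A ∈ H, p ^ (A \ U).card
      ≤ H.card * p ^ (k + 1) + U.card * (U.card + Fintype.card V * p) ^ k := by
  set w : V → ℝ := fun v => if v ∈ U then 1 else p with hw_def
  have hw (v : V) : 0 ≤ w v := by
    simp only [hw_def]
    split_ifs <;> linarith
  have hprod (A : Finset V) : ∏ v ∈ A, w v = p ^ (A \ U).card := by
    simp [hw_def, Finset.prod_ite, Finset.filter_notMem_eq_sdiff]
  have hsum : ∑ v, w v ≤ U.card + Fintype.card V * p := by
    calc ∑ v, w v ≤ ∑ v, ((if v ∈ U then 1 else 0) + p) := by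
          refine Finset.sum_le_sum fun v _ => ?_
          simp only [hw_def]
          split_ifs <;> linarith
      _ = _ := by simp [Finset.sum_add_distrib]
  have hsumU : ∑ u ∈ U, w u = U.card := by
    rw [Finset.sum_congr rfl fun u hu => if_pos hu]
    simp
  rw [← Finset.sum_filter_add_sum_filter_not H (fun A => Disjoint A U)]
  refine add_le_add ?_ ?_
  · calc _ = ∑ A ∈ H.filter (fun A => Disjoint A U), p ^ (k + 1) := by
          refine Finset.sum_congr rfl fun A hA => ?_
          rw [Finset.mem_filter] at hA
          rw [Finset.sdiff_eq_self_of_disjoint hA.2, hH A hA.1]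
      _ ≤ ∑ A ∈ H, p ^ (k + 1) :=
          Finset.sum_le_sum_of_subset_of_nonneg (Finset.filter_subset _ _)
            fun _ _ _ => by positivity
      _ = _ := by simp
  · calc _ ≤ ∑ A ∈ (Finset.powersetCard (k + 1) Finset.univ).filter (fun A => ¬ Disjoint A U),
          p ^ (A \ U).card := by
          refine Finset.sum_le_sum_of_subset_of_nonneg (Finset.filter_subset_filter _ ?_)
            fun _ _ _ => by positivity
          intro A hA
          simpa [Finset.mem_powersetCard] using hH A hA
      _ ≤ U.card * ∑ B ∈ Finset.powersetCard k Finset.univ, ∏ v ∈ B, w v := by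
          rw [← hsumU]
          simpa only [hprod] using sum_prod_powersetCard_succ_le w hw U k
      _ ≤ _ := by
          refine mul_le_mul_of_nonneg_left ?_ (Nat.cast_nonneg _)
          exact (sum_prod_powersetCard_le_pow w hw k).trans
            (pow_le_pow_left₀ (Finset.sum_nonneg fun v _ => hw v) hsum k)

theorem stmt5 (α : ℝ) (hα : 0 < α) (ℓ : ℕ) (hℓ : 1 ≤ ℓ) :
    ∃ ρ : ℝ, 0 < ρ ∧
      ∀ n : ℕ, 0 < n → ∀ H : Finset (Finset (Fin n)),
        (∀ A ∈ H, A.card = ℓ) → (H.card : ℝ) ≤ ρ * (n : ℝ) ^ ℓ →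
        ∀ p : ℝ, p ∈ Set.Icc (0 : ℝ) 1 →
          pBern (Fin n) p {ω | α * ((n : ℝ) * p) ^ ℓ ≤ ((inducedBy H ω).card : ℝ)}
            ≤ ENNReal.ofReal (Real.exp (-ρ * n * p)) := by
  obtain ⟨j, rfl⟩ : ∃ j, ℓ = j + 1 := ⟨ℓ - 1, by omega⟩
  set L : ℝ := ((j + 1 : ℕ) : ℝ) with hL
  have hL0 : 0 < L := by positivity
  set C : ℝ := 1 + L * (L + 1) ^ j with hC
  have hC0 : 0 < C := by positivity
  set ρ : ℝ := min 1 (α / (Real.exp 1 * C)) with hρ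
  have hρ0 : 0 < ρ := by positivity
  have hρ1 : ρ ≤ 1 := min_le_left _ _
  have hρC : ρ * C ≤ α * Real.exp (-1) := by
    have h : ρ ≤ α / (Real.exp 1 * C) := min_le_right _ _
    rw [le_div_iff₀ (by positivity)] at h
    rw [Real.exp_neg, ← div_eq_mul_inv, le_div_iff₀ (Real.exp_pos 1)]
    linarith
  refine ⟨ρ, hρ0, fun n hn H hH hcard p hp => ?_⟩
  have := isProbabilityMeasure_pBern (Fin n) hp
  rcases hp.1.eq_or_lt with rfl | hp0
  · simp
  set x : ℝ := n * p with hx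
  have hx0 : 0 < x := by positivity
  obtain ⟨k, hk⟩ : ∃ k, ⌈ρ * x⌉₊ = k + 1 :=
    ⟨⌈ρ * x⌉₊ - 1, by have := Nat.ceil_pos.mpr (mul_pos hρ0 hx0); omega⟩
  have hkx : (k : ℝ) ≤ ρ * x := by
    have := Nat.ceil_lt_add_one (mul_pos hρ0 hx0).le
    rw [hk] at this
    push_cast at this
    linarith
  have hxk : ρ * x ≤ (k : ℝ) + 1 := by
    have := Nat.le_ceil (ρ * x)
    rw [hk] at this
    exact_mod_cast this
  set t : ℝ := α * x ^ (j + 1) with ht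
  have ht0 : 0 < t := by positivity
  have hU (U : Finset (Fin n)) (hUk : U.card ≤ (j + 1) * k) :
      ∑ A ∈ H, p ^ (A \ U).card ≤ t * Real.exp (-1) := by
    have hUx : (U.card : ℝ) ≤ L * (ρ * x) := by
      calc (U.card : ℝ) ≤ L * k := by rw [hL]; exact_mod_cast hUk
        _ ≤ _ := by gcongr
    calc _ ≤ H.card * p ^ (j + 1) + U.card * (U.card + n * p) ^ j := by
          simpa using sum_pow_card_sdiff_le hp0.le H j hH U
      _ ≤ ρ * (n : ℝ) ^ (j + 1) * p ^ (j + 1) + L * (ρ * x) * (L * (1 * x) + x) ^ j := by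
          gcongr
          exact hUx.trans (by gcongr)
      _ = ρ * C * x ^ (j + 1) := by
          rw [show L * (1 * x) + x = (L + 1) * x by ring, mul_pow, hC, hx]
          ring
      _ ≤ α * Real.exp (-1) * x ^ (j + 1) := by gcongr
      _ = _ := by ring
  have hmoment := integral_indicator_subset_mul_card_pow_le hp H (j + 1) k hH
    (by positivity) hU (k + 1) ∅ (by simp)
  have hmarkov := mul_meas_ge_le_integral_of_nonneg (μ := pBern (Fin n) p)
    (f := fun ω => ((inducedBy H ω).card : ℝ) ^ (k + 1))
    (Filter.Eventually.of_forall fun ω => by positivity) Integrable.of_finite (t ^ (k + 1))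
  simp only [Finset.notMem_empty, false_imp_iff, implies_true, Set.ofPred_true, Set.indicator_univ,
    one_mul, Finset.card_empty, pow_zero] at hmoment
  have hset : {ω | t ≤ ((inducedBy H ω).card : ℝ)}
      = {ω | t ^ (k + 1) ≤ ((inducedBy H ω).card : ℝ) ^ (k + 1)} := by
    ext ω
    exact (pow_le_pow_iff_left₀ ht0.le (Nat.cast_nonneg _) k.succ_ne_zero).symm
  rw [hset, ← ofReal_measureReal]
  refine ENNReal.ofReal_le_ofReal ?_
  have hfin := hmarkov.trans hmoment
  rw [mul_pow t] at hfin
  refine (le_of_mul_le_mul_left hfin (by positivity)).trans ?_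
  rw [← Real.exp_nat_mul, Real.exp_le_exp]
  push_cast
  linarith
end

section
/- Let H be a strictly 2-balanced graph with v_H vertices and e_H ≥ 2 edges. There exists n₀ such that for every n ≥ n₀, every p with n^{−1/m₂(H)} ≤ p ≤ 1, and every edge e of the complete graph K_n: Pr(|∂∂_e𝓗[G_{n,p}]| ≥ 4·e_H²·n^{v_H−2}·p^{e_H−2}) ≤ n^{−6}, where 𝓗 is the hypergraph on vertex set E(K_n) whose hyperedges are the edge sets of copies of H in K_n. -/
open MeasureTheory Filter Topology

noncomputable def gnp (n : ℕ) (p : ℝ) : Measure (Sym2 (Fin n) → Bool) :=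
  Measure.pi fun _ => bern p

/-- The binomial random graph `G_{n,p}`, as a function of the Bernoulli sample `ω`. -/
def graphOf {n : ℕ} (ω : Sym2 (Fin n) → Bool) : SimpleGraph (Fin n) :=
  SimpleGraph.fromEdgeSet {e | ω e = true}

/-- The 2-density `m₂(H)`. -/
noncomputable def twoDensity {α : Type*} (H : SimpleGraph α) : ℝ :=
  sSup {x : ℝ | ∃ F : H.Subgraph, 2 ≤ Nat.card F.edgeSet ∧
    x = ((Nat.card F.edgeSet : ℝ) - 1) / ((Nat.card F.verts : ℝ) - 2)}

/-- `H` is strictly 2-balanced. -/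
def StrictlyTwoBalanced {α : Type*} (H : SimpleGraph α) : Prop :=
  ∀ F : H.Subgraph, 2 ≤ Nat.card F.edgeSet → F ≠ ⊤ →
    ((Nat.card F.edgeSet : ℝ) - 1) / ((Nat.card F.verts : ℝ) - 2) < twoDensity H

/-- The link `∂_e 𝓖 = {A ∖ {e} : e ∈ A ∈ 𝓖}` of a hypergraph whose vertices are
potential edges. -/
def delH {β : Type*} (e : β) (Gc : Set (Set β)) : Set (Set β) :=
  {A | ∃ B ∈ Gc, e ∈ B ∧ A = B \ {e}}

/-- `∂𝓖 = ⋃_f ∂_f 𝓖`. -/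
def bdH {β : Type*} (Gc : Set (Set β)) : Set (Set β) :=
  ⋃ e : β, delH e Gc

/-- The hypergraph (on vertex set `E(K_n)`) of edge sets of copies of `H` in `K_n`. -/
def copies {V : Type*} (H : SimpleGraph V) (n : ℕ) : Set (Set (Sym2 (Fin n))) :=
  {E | ∃ f : V ↪ Fin n, E = Sym2.map f '' H.edgeSet}

lemma isProbabilityMeasure_bern_s8 {p : ℝ} (hp0 : 0 ≤ p) (hp1 : p ≤ 1) :
    IsProbabilityMeasure (bern p) := by
  refine ⟨?_⟩
  simp only [bern, Measure.add_apply, Measure.smul_apply, measure_univ, smul_eq_mul, mul_one]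
  rw [← ENNReal.ofReal_add hp0 (by linarith)]
  simp

lemma isProbabilityMeasure_gnp (n : ℕ) {p : ℝ} (hp0 : 0 ≤ p) (hp1 : p ≤ 1) :
    IsProbabilityMeasure (gnp n p) := by
  have := isProbabilityMeasure_bern_s8 hp0 hp1
  unfold gnp
  infer_instance

/-- The indicator of the event that all potential edges in `U` are present. -/
def presence {β : Type*} (U : Finset β) (ω : β → Bool) : ℝ :=
  if ∀ f ∈ U, ω f = true then 1 else 0

lemma presence_nonneg {β : Type*} (U : Finset β) (ω : β → Bool) : 0 ≤ presence U ω := by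
  unfold presence
  split_ifs <;> norm_num

lemma presence_mul_presence {β : Type*} [DecidableEq β] (U W : Finset β) (ω : β → Bool) :
    presence U ω * presence W ω = presence (U ∪ W) ω := by
  unfold presence
  simp only [Finset.mem_union, or_imp, forall_and]
  split_ifs <;> simp_all

lemma integral_presence (n : ℕ) {p : ℝ} (hp0 : 0 ≤ p) (hp1 : p ≤ 1)
    (U : Finset (Sym2 (Fin n))) : ∫ ω, presence U ω ∂gnp n p = p ^ U.card := by
  have := isProbabilityMeasure_bern_s8 hp0 hp1
  have hset : {ω : Sym2 (Fin n) → Bool | ∀ f ∈ U, ω f = true}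
      = Set.univ.pi fun f => if f ∈ U then {true} else Set.univ := by
    ext ω
    simp only [Set.mem_ofPred_eq, Set.mem_univ_pi]
    refine forall_congr' fun f => ?_
    by_cases hf : f ∈ U <;> simp [hf]
  have hind : (fun ω => presence U ω)
      = Set.indicator {ω : Sym2 (Fin n) → Bool | ∀ f ∈ U, ω f = true} 1 := by
    ext ω
    simp [presence, Set.indicator_apply]
  rw [hind, integral_indicator_one (Set.toFinite _).measurableSet, hset, measureReal_def, gnp,
    Measure.pi_pi]
  have hterm : ∀ f : Sym2 (Fin n), bern p (if f ∈ U then {true} else Set.univ)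
      = if f ∈ U then ENNReal.ofReal p else 1 := by
    intro f
    by_cases hf : f ∈ U
    · simp [hf, bern]
    · rw [if_neg hf, if_neg hf, measure_univ]
  simp_rw [hterm]
  rw [Finset.prod_ite_mem]
  simp [ENNReal.toReal_ofReal hp0]

/-- A moment bound for sums of indicators of increasing events: it suffices to control the
conditional expectation of the sum given that few edges are present. -/
lemma integral_presence_mul_sum_pow_le (n : ℕ) {p : ℝ} (hp0 : 0 ≤ p) (hp1 : p ≤ 1) {ι : Type*}
    (I : Finset ι) (A : ι → Finset (Sym2 (Fin n))) (d M : ℕ) (B : ℝ)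
    (hd : ∀ i ∈ I, (A i).card ≤ d)
    (hB : ∀ U : Finset (Sym2 (Fin n)), U.card ≤ M → ∑ i ∈ I, p ^ (A i \ U).card ≤ B) (k : ℕ) :
    ∀ U : Finset (Sym2 (Fin n)), U.card + k * d ≤ M →
      ∫ ω, presence U ω * (∑ i ∈ I, presence (A i) ω) ^ k ∂gnp n p ≤ p ^ U.card * B ^ k := by
  have := isProbabilityMeasure_gnp n hp0 hp1
  have hB0 : 0 ≤ B := le_trans (Finset.sum_nonneg fun i _ => by positivity) (hB ∅ (by simp))
  induction k with
  | zero =>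
    intro U _
    simp [integral_presence n hp0 hp1]
  | succ k ih =>
    intro U hU
    have hexp : ∀ ω, presence U ω * (∑ i ∈ I, presence (A i) ω) ^ (k + 1)
        = ∑ i ∈ I, presence (U ∪ A i) ω * (∑ i ∈ I, presence (A i) ω) ^ k := by
      intro ω
      simp_rw [← presence_mul_presence]
      rw [← Finset.sum_mul, ← Finset.mul_sum]
      ring
    simp_rw [hexp]
    rw [integral_finsetSum _ fun i _ => Integrable.of_finite]
    calc _ ≤ ∑ i ∈ I, p ^ (U ∪ A i).card * B ^ k := by
          refine Finset.sum_le_sum fun i hi => ih _ ?_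
          have h1 := Finset.card_union_le U (A i)
          have h2 := hd i hi
          rw [add_mul] at hU
          omega
      _ = p ^ U.card * B ^ k * ∑ i ∈ I, p ^ (A i \ U).card := by
          rw [Finset.mul_sum]
          refine Finset.sum_congr rfl fun i _ => ?_
          rw [← Finset.union_sdiff_self_eq_union, Finset.card_union_of_disjoint
            Finset.disjoint_sdiff, pow_add]
          ring
      _ ≤ p ^ U.card * B ^ k * B := by
          gcongr
          exact hB U (by omega)
      _ = _ := by ring

lemma gnp_sum_presence_ge_le (n : ℕ) {p : ℝ} (hp0 : 0 ≤ p) (hp1 : p ≤ 1) {ι : Type*}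
    (I : Finset ι) (A : ι → Finset (Sym2 (Fin n))) (d k : ℕ) (B t : ℝ) (ht : 0 < t)
    (hd : ∀ i ∈ I, (A i).card ≤ d)
    (hB : ∀ U : Finset (Sym2 (Fin n)), U.card ≤ k * d → ∑ i ∈ I, p ^ (A i \ U).card ≤ B) :
    gnp n p {ω | t ≤ ∑ i ∈ I, presence (A i) ω} ≤ ENNReal.ofReal ((B / t) ^ k) := by
  have := isProbabilityMeasure_gnp n hp0 hp1
  have hmom := integral_presence_mul_sum_pow_le n hp0 hp1 I A d (k * d) B hd hB k ∅ (by simp)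
  have hmarkov := mul_meas_ge_le_integral_of_nonneg (μ := gnp n p)
    (f := fun ω => (∑ i ∈ I, presence (A i) ω) ^ k)
    (Eventually.of_forall fun ω => pow_nonneg
      (Finset.sum_nonneg fun i _ => presence_nonneg (A i) ω) k) Integrable.of_finite (t ^ k)
  have hempty : ∀ ω : Sym2 (Fin n) → Bool, presence ∅ ω = 1 := fun ω => by simp [presence]
  simp only [hempty, one_mul, Finset.card_empty, pow_zero] at hmom
  rw [← ENNReal.ofReal_toReal (measure_ne_top (gnp n p) _), ← measureReal_def]
  refine ENNReal.ofReal_le_ofReal ?_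
  rw [div_pow, le_div_iff₀ (by positivity), mul_comm]
  refine le_trans (mul_le_mul_of_nonneg_left (measureReal_mono ?_) (by positivity))
    (hmarkov.trans hmom)
  intro ω hω
  exact pow_le_pow_left₀ ht.le hω k

lemma card_embedding_filter_le {V : Type*} [Fintype V] [DecidableEq V] (n : ℕ) (W : Finset V)
    (R : V → Finset (Fin n)) :
    ((Finset.univ : Finset (V ↪ Fin n)).filter fun φ => ∀ v ∈ W, φ v ∈ R v).card
      ≤ (∏ v ∈ W, (R v).card) * n ^ (Fintype.card V - W.card) := by
  calc _ ≤ (Fintype.piFinset fun v => if v ∈ W then R v else Finset.univ).card := by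
        refine Finset.card_le_card_of_injOn (fun φ => (φ : V → Fin n)) ?_
          (fun φ _ ψ _ h => DFunLike.coe_injective h)
        intro φ hφ
        simp only [Finset.coe_filter, Finset.mem_univ, true_and, Set.mem_ofPred_eq] at hφ
        simp only [Finset.mem_coe, Fintype.mem_piFinset]
        intro v
        by_cases hv : v ∈ W <;> simp [hv, hφ]
    _ = _ := by
        rw [Fintype.card_piFinset, ← Finset.prod_mul_prod_compl W]
        congr 1
        · exact Finset.prod_congr rfl fun v hv => by simp [hv]
        · rw [Finset.prod_congr rfl (g := fun _ => n)
            fun v hv => by simp [Finset.mem_compl.1 hv]]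
          simp [Finset.card_compl]

/-- The set of endpoints of a finite set of potential edges. -/
def endpoints {α : Type*} [DecidableEq α] (S : Finset (Sym2 α)) : Finset α :=
  S.biUnion Sym2.toFinset

lemma mem_endpoints {α : Type*} [DecidableEq α] {S : Finset (Sym2 α)} {v : α} :
    v ∈ endpoints S ↔ ∃ x ∈ S, v ∈ x := by
  simp [endpoints]

lemma card_endpoints_le {α : Type*} [DecidableEq α] (S : Finset (Sym2 α)) :
    (endpoints S).card ≤ 2 * S.card := by
  rw [mul_comm]
  refine Finset.card_biUnion_le_card_mul _ _ _ fun x _ => ?_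
  induction x with | _ a b => ?_
  rw [Sym2.toFinset_mk_eq]
  exact Finset.card_le_two

lemma two_lt_card_endpoints {α : Type*} [DecidableEq α] {S : Finset (Sym2 α)}
    (hdiag : ∀ x ∈ S, ¬ x.IsDiag) (hS : 2 ≤ S.card) : 2 < (endpoints S).card := by
  by_contra! hle
  obtain ⟨x, hx, y, hy, hxy⟩ := Finset.one_lt_card.1 hS
  refine hxy ?_
  have hsub : ∀ z ∈ S, z.toFinset = endpoints S := fun z hz => by
    refine Finset.eq_of_subset_of_card_le (Finset.subset_biUnion_of_mem _ hz) ?_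
    rwa [Sym2.card_toFinset_of_not_isDiag z (hdiag z hz)]
  refine Sym2.ext fun v => ?_
  rw [← Sym2.mem_toFinset, ← Sym2.mem_toFinset, hsub x hx, hsub y hy]

lemma StrictlyTwoBalanced.div_twoDensity_lt {V : Type*} [DecidableEq V]
    {H : SimpleGraph V} (hbal : StrictlyTwoBalanced H) (S : Finset (Sym2 V))
    (hS : (S : Set (Sym2 V)) ⊂ H.edgeSet) (hcard : 2 ≤ S.card) :
    ((S.card : ℝ) - 1) / twoDensity H < ((endpoints S).card : ℝ) - 2 := by
  let F : H.Subgraph :=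
    { verts := endpoints S
      Adj := fun a b => s(a, b) ∈ S
      adj_sub := fun h => hS.1 h
      edge_vert := fun h => by
        rw [Finset.mem_coe, mem_endpoints]
        exact ⟨_, h, Sym2.mem_mk_left _ _⟩
      symm := ⟨fun a b h => by rwa [Sym2.eq_swap]⟩ }
  have hedge : F.edgeSet = S := by
    ext x
    induction x with | _ a b => ?_
    simp [F]
  have hne : F ≠ ⊤ := by
    intro h
    rw [h, SimpleGraph.Subgraph.edgeSet_top] at hedge
    exact hS.ne hedge.symm
  have hFe : Nat.card F.edgeSet = S.card := by
    rw [hedge]; simp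
  have hFv : Nat.card F.verts = (endpoints S).card := by
    simp [F]
  have hlt := hbal F (by omega) hne
  rw [hFe, hFv] at hlt
  have hw : (2 : ℝ) < (endpoints S).card := by
    exact_mod_cast two_lt_card_endpoints
      (fun x hx => H.not_isDiag_of_mem_edgeSet (hS.1 hx)) hcard
  have hs : (2 : ℝ) ≤ S.card := by exact_mod_cast hcard
  have hm : 0 < twoDensity H := lt_trans (div_pos (by linarith) (by linarith)) hlt
  rw [div_lt_iff₀ (by linarith)] at hlt
  rw [div_lt_iff₀ hm]
  linarith

lemma StrictlyTwoBalanced.exists_gap {V : Type*} [Fintype V] [DecidableEq V]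
    {H : SimpleGraph V} (hbal : StrictlyTwoBalanced H) :
    ∃ ε : ℝ, 0 < ε ∧ ∀ S : Finset (Sym2 V), (S : Set (Sym2 V)) ⊂ H.edgeSet → 2 ≤ S.card →
      ((S.card : ℝ) - 1) / twoDensity H + ε ≤ ((endpoints S).card : ℝ) - 2 := by
  have hev : ∀ᶠ ε : ℝ in 𝓝[>] 0, ∀ S : Finset (Sym2 V), (S : Set (Sym2 V)) ⊂ H.edgeSet →
      2 ≤ S.card →
        ((S.card : ℝ) - 1) / twoDensity H + ε ≤ ((endpoints S).card : ℝ) - 2 := by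
    rw [eventually_all]
    intro S
    by_cases h : (S : Set (Sym2 V)) ⊂ H.edgeSet ∧ 2 ≤ S.card
    · have hlt := sub_pos.2 (hbal.div_twoDensity_lt S h.1 h.2)
      filter_upwards [nhdsWithin_le_nhds (Iio_mem_nhds hlt)] with ε hε _ _
      have := Set.mem_Iio.1 hε
      linarith
    · exact Eventually.of_forall fun ε h1 h2 => absurd ⟨h1, h2⟩ h
  obtain ⟨ε, hε, hpos⟩ := (hev.and self_mem_nhdsWithin).exists
  exact ⟨ε, hpos, hε⟩

lemma exists_polylog_le_rpow (a v : ℕ) {ε : ℝ} (hε : 0 < ε) :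
    ∃ n₀ : ℕ, ∀ n : ℕ, n₀ ≤ n → 1 ≤ n ∧
      (2 : ℝ) ^ a * (2 * ((⌈24 * Real.log n⌉₊ * a : ℕ) : ℝ) + 2) ^ v ≤ (n : ℝ) ^ ε := by
  have hδ : 0 < ε / (v + 1) := by positivity
  have hO : (fun x : ℝ => (2 : ℝ) ^ a * (2 * ((24 * Real.log x + 1) * a) + 2))
      =o[atTop] fun x => x ^ (ε / (v + 1)) := by
    have h1 := (isLittleO_log_rpow_atTop hδ).const_mul_left ((2 : ℝ) ^ a * 48 * a)
    have h2 : (fun _ : ℝ => (2 : ℝ) ^ a * (2 * a + 2)) =o[atTop] fun x => x ^ (ε / (v + 1)) :=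
      Asymptotics.isLittleO_const_left.2
        (Or.inr (tendsto_norm_atTop_atTop.comp (tendsto_rpow_atTop hδ)))
    refine (h1.add h2).congr_left fun x => by ring
  have hev := tendsto_natCast_atTop_atTop (R := ℝ) |>.eventually (hO.bound one_pos)
  obtain ⟨n₀, hn₀⟩ := eventually_atTop.1 (hev.and (eventually_ge_atTop 1))
  refine ⟨n₀, fun n hn => ?_⟩
  obtain ⟨h, hn1⟩ := hn₀ n hn
  refine ⟨hn1, ?_⟩
  have hn1' : (1 : ℝ) ≤ n := by exact_mod_cast hn1
  have hlog : 0 ≤ Real.log n := Real.log_nonneg hn1'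
  have hceil : (⌈24 * Real.log n⌉₊ : ℝ) ≤ 24 * Real.log n + 1 :=
    (Nat.ceil_lt_add_one (by positivity)).le
  have hbase : (2 : ℝ) ^ a * (2 * ((⌈24 * Real.log n⌉₊ * a : ℕ) : ℝ) + 2)
      ≤ (n : ℝ) ^ (ε / (v + 1)) := by
    refine le_trans ?_ ((le_abs_self _).trans (h.trans_eq ?_))
    · push_cast
      gcongr
    · rw [one_mul, Real.norm_of_nonneg (by positivity)]
  have hpow : (1 : ℝ) ≤ 2 ^ a := one_le_pow₀ (by norm_num)
  set c : ℝ := 2 * ((⌈24 * Real.log n⌉₊ * a : ℕ) : ℝ) + 2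
  have hc : 1 ≤ c := by
    have : (0 : ℝ) ≤ ((⌈24 * Real.log n⌉₊ * a : ℕ) : ℝ) := by positivity
    simp only [c]; linarith
  calc (2 : ℝ) ^ a * c ^ v ≤ ((2 : ℝ) ^ a) ^ (v + 1) * c ^ (v + 1) := by
        gcongr
        · exact le_self_pow₀ hpow (by omega)
        · omega
    _ = (2 ^ a * c) ^ (v + 1) := by rw [mul_pow]
    _ ≤ ((n : ℝ) ^ (ε / (v + 1))) ^ (v + 1) := by gcongr
    _ = (n : ℝ) ^ ε := by
        rw [← Real.rpow_natCast, ← Real.rpow_mul (by positivity)]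
        congr 1
        push_cast
        field_simp

lemma three_quarters_pow_ceil_log_le {n : ℕ} (hn : 1 ≤ n) :
    (3 / 4 : ℝ) ^ ⌈24 * Real.log n⌉₊ ≤ (n : ℝ) ^ (-(6 : ℝ)) := by
  have hn' : (0 : ℝ) < n := by exact_mod_cast hn
  calc (3 / 4 : ℝ) ^ ⌈24 * Real.log n⌉₊ ≤ Real.exp (-(1 / 4)) ^ ⌈24 * Real.log n⌉₊ := by
        gcongr
        have := Real.add_one_le_exp (-(1 / 4) : ℝ)
        linarith
    _ = Real.exp (⌈24 * Real.log n⌉₊ * (-(1 / 4))) := by rw [Real.exp_nat_mul]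
    _ ≤ Real.exp (Real.log n * (-6)) := by
        refine Real.exp_le_exp.2 ?_
        have := Nat.le_ceil (24 * Real.log n)
        linarith
    _ = _ := by rw [Real.rpow_def_of_pos hn']

lemma pow_mul_pow_le_of_gap {n : ℕ} (hn : 1 ≤ n) {p m ε : ℝ} (hp : (n : ℝ) ^ (-(1 / m)) ≤ p)
    {v w s d : ℕ} (hw : 2 ≤ w) (hwv : w ≤ v) (hsd : s ≤ d) (h : (s : ℝ) / m + ε ≤ (w : ℝ) - 2) :
    (n : ℝ) ^ (v - w) * p ^ (d - s) ≤ (n : ℝ) ^ (v - 2) * p ^ d * (n : ℝ) ^ (-ε) := by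
  have hn1 : (1 : ℝ) ≤ n := by exact_mod_cast hn
  have hn0 : (0 : ℝ) < n := by linarith
  have hp0 : 0 < p := lt_of_lt_of_le (by positivity) hp
  have hone : (1 : ℝ) ≤ (n : ℝ) ^ (w - 2) * p ^ s * (n : ℝ) ^ (-ε) := by
    calc (1 : ℝ) ≤ (n : ℝ) ^ (((w : ℝ) - 2) + -(1 / m) * s + -ε) := by
          refine Real.one_le_rpow hn1 ?_
          have : -(1 / m) * s = -(s / m) := by ring
          linarith
      _ = (n : ℝ) ^ (w - 2) * ((n : ℝ) ^ (-(1 / m))) ^ s * (n : ℝ) ^ (-ε) := by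
          rw [Real.rpow_add hn0, Real.rpow_add hn0, Real.rpow_mul hn0.le, Real.rpow_natCast,
            ← Real.rpow_natCast (n : ℝ) (w - 2), Nat.cast_sub hw, Nat.cast_ofNat]
      _ ≤ _ := by gcongr
  have hv : v - 2 = (v - w) + (w - 2) := by omega
  have hd : d = (d - s) + s := by omega
  calc (n : ℝ) ^ (v - w) * p ^ (d - s) = (n : ℝ) ^ (v - w) * p ^ (d - s) * 1 := by ring
    _ ≤ (n : ℝ) ^ (v - w) * p ^ (d - s) * ((n : ℝ) ^ (w - 2) * p ^ s * (n : ℝ) ^ (-ε)) := by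
        gcongr
    _ = (n : ℝ) ^ ((v - w) + (w - 2)) * p ^ ((d - s) + s) * (n : ℝ) ^ (-ε) := by
        rw [pow_add, pow_add]
        ring
    _ = _ := by rw [← hv, ← hd]

lemma card_embedding_map_eq_le {V : Type*} [Fintype V] [DecidableEq V] (n : ℕ) (h : Sym2 V)
    (hh : ¬ h.IsDiag) (e : Sym2 (Fin n)) :
    ((Finset.univ : Finset (V ↪ Fin n)).filter fun φ : V ↪ Fin n => Sym2.map φ h = e).card
      ≤ 2 * n ^ (Fintype.card V - 2) := by
  induction h with | _ a b => ?_
  induction e with | _ x y => ?_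
  have hab : a ≠ b := by simpa using hh
  have key : ∀ x y : Fin n,
      ((Finset.univ : Finset (V ↪ Fin n)).filter fun φ : V ↪ Fin n => φ a = x ∧ φ b = y).card
        ≤ n ^ (Fintype.card V - 2) := by
    intro x y
    have := card_embedding_filter_le n {a, b} fun v => if v = a then {x} else {y}
    rw [Finset.card_pair hab] at this
    simpa [hab, hab.symm, Finset.prod_pair] using this
  have hsub : ((Finset.univ : Finset (V ↪ Fin n)).filter fun φ : V ↪ Fin n => Sym2.map φ s(a, b) = s(x, y))
      = (Finset.univ.filter fun φ : V ↪ Fin n => φ a = x ∧ φ b = y)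
        ∪ Finset.univ.filter fun φ : V ↪ Fin n => φ a = y ∧ φ b = x := by
    ext φ
    simp
  rw [hsub, two_mul]
  exact (Finset.card_union_le _ _).trans (add_le_add (key x y) (key y x))

lemma card_embedding_extension_le {V : Type*} [Fintype V] [DecidableEq V] (n : ℕ)
    (S : Finset (Sym2 V)) (U : Finset (Sym2 (Fin n))) :
    ((Finset.univ : Finset (V ↪ Fin n)).filter fun φ : V ↪ Fin n => ∀ x ∈ S, Sym2.map φ x ∈ U).card
      ≤ (2 * U.card) ^ (endpoints S).card * n ^ (Fintype.card V - (endpoints S).card) := by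
  refine (Finset.card_le_card (t := Finset.univ.filter fun φ : V ↪ Fin n =>
    ∀ v ∈ endpoints S, φ v ∈ endpoints U) ?_).trans
    ((card_embedding_filter_le n (endpoints S) fun _ => endpoints U).trans ?_)
  · refine Finset.monotone_filter_right _ fun φ _ hφ v hv => ?_
    obtain ⟨x, hx, hvx⟩ := mem_endpoints.1 hv
    exact mem_endpoints.2 ⟨_, hφ x hx, Sym2.mem_map.2 ⟨v, hvx, rfl⟩⟩
  · rw [Finset.prod_const]
    gcongr
    exact card_endpoints_le U

/-- The conditional expected number of copies of `D ∪ {h}` extending `e`, given that the edges in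
`U` are present and disregarding the edge `e` itself. -/
lemma sum_pow_card_sdiff_le_s8 {V : Type*} [Fintype V] [DecidableEq V] {n : ℕ} (hn : 1 ≤ n)
    {p m ε : ℝ} (hp : (n : ℝ) ^ (-(1 / m)) ≤ p) (D : Finset (Sym2 V)) (h : Sym2 V)
    (hh : ¬ h.IsDiag)
    (hgap : ∀ S ⊆ D, S.Nonempty → 2 ≤ (endpoints (insert h S)).card ∧
      (S.card : ℝ) / m + ε ≤ ((endpoints (insert h S)).card : ℝ) - 2)
    (e : Sym2 (Fin n)) (U : Finset (Sym2 (Fin n))) :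
    ∑ φ ∈ Finset.univ.filter (fun φ : V ↪ Fin n => Sym2.map φ h = e), p ^ (D.image (Sym2.map φ) \ U).card
      ≤ (n : ℝ) ^ (Fintype.card V - 2) * p ^ D.card *
        (2 + 2 ^ D.card * (2 * (U.card : ℝ) + 2) ^ Fintype.card V * (n : ℝ) ^ (-ε)) := by
  have hn0 : (0 : ℝ) < n := by exact_mod_cast hn
  have hp0 : 0 < p := lt_of_lt_of_le (by positivity) hp
  have hterm : ∀ φ : V ↪ Fin n, p ^ (D.image (Sym2.map φ) \ U).card
      ≤ ∑ S ∈ D.powerset, if ∀ x ∈ S, Sym2.map φ x ∈ U then p ^ (D.card - S.card) else 0 := by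
    intro φ
    have hcard : (D.image (Sym2.map φ) \ U).card
        = D.card - (D.filter fun x => Sym2.map φ x ∈ U).card := by
      have himg : D.image (Sym2.map φ) \ U
          = (D.filter fun x => ¬ Sym2.map φ x ∈ U).image (Sym2.map φ) := by
        ext y
        simp only [Finset.mem_sdiff, Finset.mem_image, Finset.mem_filter]
        constructor
        · rintro ⟨⟨x, hx, rfl⟩, hy⟩
          exact ⟨x, ⟨hx, hy⟩, rfl⟩
        · rintro ⟨x, ⟨hx, hy⟩, rfl⟩
          exact ⟨⟨x, hx, rfl⟩, hy⟩
      rw [himg, Finset.card_image_of_injective _ (Sym2.map.injective φ.injective)]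
      have := Finset.card_filter_add_card_filter_not (s := D) fun x => Sym2.map φ x ∈ U
      omega
    have hle := Finset.single_le_sum
      (f := fun S => if ∀ x ∈ S, Sym2.map φ x ∈ U then p ^ (D.card - S.card) else 0)
      (fun S _ => by split_ifs <;> positivity)
      (Finset.mem_powerset.2 (Finset.filter_subset (fun x => Sym2.map φ x ∈ U) D))
    rw [hcard]
    refine le_trans (le_of_eq ?_) hle
    rw [if_pos fun x hx => (Finset.mem_filter.1 hx).2]
  set N : ℝ := (n : ℝ) ^ (Fintype.card V - 2) * p ^ D.card with hN
  set c : ℝ := (2 * (U.card : ℝ) + 2) ^ Fintype.card V * (n : ℝ) ^ (-ε) with hc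
  have hN0 : 0 < N := by positivity
  have hc0 : 0 < c := by positivity
  have hS : ∀ S ∈ D.powerset,
      ∑ φ ∈ Finset.univ.filter (fun φ : V ↪ Fin n => Sym2.map φ h = e),
        (if ∀ x ∈ S, Sym2.map φ x ∈ U then p ^ (D.card - S.card) else 0)
      ≤ (if S = ∅ then 2 * N else 0) + N * c := by
    intro S hSD
    rw [Finset.mem_powerset] at hSD
    rw [← Finset.sum_filter, Finset.sum_const, nsmul_eq_mul, Finset.filter_filter]
    rcases S.eq_empty_or_nonempty with rfl | hne
    · have hcount : (((Finset.univ : Finset (V ↪ Fin n)).filter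
          fun φ : V ↪ Fin n => Sym2.map φ h = e).card : ℝ) ≤ 2 * (n : ℝ) ^ (Fintype.card V - 2) := by
        exact_mod_cast card_embedding_map_eq_le n h hh e
      simp only [Finset.notMem_empty, false_imp_iff, implies_true, and_true, if_true,
        Finset.card_empty, Nat.sub_zero]
      calc _ ≤ 2 * (n : ℝ) ^ (Fintype.card V - 2) * p ^ D.card := by gcongr
        _ = 2 * N := by rw [hN]; ring
        _ ≤ _ := le_add_of_nonneg_right (by positivity)
    · obtain ⟨hw, hgap'⟩ := hgap S hSD hne
      have hwV : (endpoints (insert h S)).card ≤ Fintype.card V := Finset.card_le_univ _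
      have hnat : ((Finset.univ : Finset (V ↪ Fin n)).filter
          fun φ : V ↪ Fin n => Sym2.map φ h = e ∧ ∀ x ∈ S, Sym2.map φ x ∈ U).card
          ≤ (2 * U.card + 2) ^ Fintype.card V
            * n ^ (Fintype.card V - (endpoints (insert h S)).card) := by
        refine (Finset.card_le_card (t := Finset.univ.filter fun φ : V ↪ Fin n =>
          ∀ x ∈ insert h S, Sym2.map φ x ∈ insert e U) ?_).trans
          ((card_embedding_extension_le n (insert h S) (insert e U)).trans ?_)
        · refine Finset.monotone_filter_right _ fun φ _ hφ x hx => ?_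
          rcases Finset.mem_insert.1 hx with rfl | hx
          · exact Finset.mem_insert.2 (Or.inl hφ.1)
          · exact Finset.mem_insert_of_mem (hφ.2 x hx)
        · have := Finset.card_insert_le e U
          refine Nat.mul_le_mul_right _ ((Nat.pow_le_pow_left ?_ _).trans
            (Nat.pow_le_pow_right (by omega) hwV))
          omega
      rw [if_neg hne.ne_empty, zero_add]
      calc _ ≤ ((2 * (U.card : ℝ) + 2) ^ Fintype.card V
            * (n : ℝ) ^ (Fintype.card V - (endpoints (insert h S)).card))
            * p ^ (D.card - S.card) := by
            gcongr
            exact_mod_cast hnat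
        _ = (2 * (U.card : ℝ) + 2) ^ Fintype.card V
            * ((n : ℝ) ^ (Fintype.card V - (endpoints (insert h S)).card)
              * p ^ (D.card - S.card)) := by ring
        _ ≤ (2 * (U.card : ℝ) + 2) ^ Fintype.card V * (N * (n : ℝ) ^ (-ε)) := by
            refine mul_le_mul_of_nonneg_left ?_ (by positivity)
            exact pow_mul_pow_le_of_gap hn hp hw hwV (Finset.card_le_card hSD) hgap'
        _ = N * c := by rw [hc]; ring
  calc _ ≤ ∑ φ ∈ Finset.univ.filter (fun φ : V ↪ Fin n => Sym2.map φ h = e), ∑ S ∈ D.powerset,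
        (if ∀ x ∈ S, Sym2.map φ x ∈ U then p ^ (D.card - S.card) else 0) :=
        Finset.sum_le_sum fun φ _ => hterm φ
    _ ≤ ∑ S ∈ D.powerset, ((if S = ∅ then 2 * N else 0) + N * c) := by
        rw [Finset.sum_comm]
        exact Finset.sum_le_sum hS
    _ = N * (2 + 2 ^ D.card * (2 * (U.card : ℝ) + 2) ^ Fintype.card V * (n : ℝ) ^ (-ε)) := by
        rw [Finset.sum_add_distrib, Finset.sum_ite_eq' _ ∅, if_pos (Finset.empty_mem_powerset D),
          Finset.sum_const, Finset.card_powerset, nsmul_eq_mul, hc]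
        push_cast
        ring

lemma card_bdH_delH_copies_le {V : Type*} [Fintype V] [DecidableEq V] (H : SimpleGraph V)
    (E : Finset (Sym2 V)) (hE : (E : Set (Sym2 V)) = H.edgeSet) {n : ℕ} (e : Sym2 (Fin n))
    (ω : Sym2 (Fin n) → Bool) :
    (Nat.card {A ∈ bdH (delH e (copies H n)) | A ⊆ (graphOf ω).edgeSet} : ℝ)
      ≤ ∑ i ∈ E.offDiag.sigma fun q =>
            (Finset.univ : Finset (V ↪ Fin n)).filter fun φ : V ↪ Fin n => Sym2.map φ q.1 = e,
          presence (((E.erase i.1.1).erase i.1.2).image (Sym2.map i.2)) ω := by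
  set J := Finset.filter (fun i : (_ : Sym2 V × Sym2 V) × (V ↪ Fin n) =>
      ∀ f ∈ ((E.erase i.1.1).erase i.1.2).image (Sym2.map i.2), ω f = true)
    (E.offDiag.sigma fun q =>
      (Finset.univ : Finset (V ↪ Fin n)).filter fun φ : V ↪ Fin n => Sym2.map φ q.1 = e) with hJ
  refine le_of_le_of_eq (b := (J.card : ℝ)) (Nat.cast_le.2 ?_) ?_
  swap
  · rw [hJ, Finset.card_filter, Nat.cast_sum]
    refine Finset.sum_congr rfl fun i _ => ?_
    rw [Nat.cast_ite, Nat.cast_one, Nat.cast_zero, presence]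
    congr
  calc _ ≤ ((fun i : (_ : Sym2 V × Sym2 V) × (V ↪ Fin n) =>
        ((((E.erase i.1.1).erase i.1.2).image (Sym2.map i.2) : Finset (Sym2 (Fin n))) :
          Set (Sym2 (Fin n)))) '' (J : Set _)).ncard := by
        refine Set.ncard_le_ncard ?_ (Set.toFinite _)
        rintro A ⟨hA, hAω⟩
        obtain ⟨f, B, ⟨C, ⟨φ, rfl⟩, heC, rfl⟩, hf, rfl⟩ := Set.mem_iUnion.1 hA
        obtain ⟨h₁, hh₁, rfl⟩ := heC
        obtain ⟨⟨h₂, hh₂, rfl⟩, hne⟩ := hf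
        rw [← hE] at hh₁ hh₂
        have hinj : Function.Injective (Sym2.map φ) := Sym2.map.injective φ.injective
        have himg : ((((E.erase h₁).erase h₂).image (Sym2.map φ) : Finset (Sym2 (Fin n))) :
            Set (Sym2 (Fin n)))
            = ((Sym2.map φ '' H.edgeSet) \ {Sym2.map φ h₁}) \ {Sym2.map φ h₂} := by
          rw [← hE, Finset.coe_image, Finset.coe_erase, Finset.coe_erase,
            Set.image_sdiff hinj, Set.image_sdiff hinj, Set.image_singleton, Set.image_singleton]
        refine ⟨⟨(h₁, h₂), φ⟩, ?_, himg⟩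
        rw [Finset.mem_coe, hJ, Finset.mem_filter, Finset.mem_sigma, Finset.mem_offDiag]
        refine ⟨⟨⟨hh₁, hh₂, fun h => hne (congrArg (Sym2.map φ) (Eq.symm h))⟩, by simp⟩, fun g hg => ?_⟩
        have hgω := hAω (himg ▸ Finset.mem_coe.2 hg)
        rw [graphOf, SimpleGraph.edgeSet_fromEdgeSet] at hgω
        exact hgω.1
    _ ≤ (J : Set ((_ : Sym2 V × Sym2 V) × (V ↪ Fin n))).ncard :=
        Set.ncard_image_le (Set.toFinite _)
    _ = J.card := Set.ncard_coe_finset J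

theorem stmt8 {V : Type} [Fintype V] (H : SimpleGraph V)
    (hbal : StrictlyTwoBalanced H) (h2 : 2 ≤ Nat.card H.edgeSet) :
    ∃ n₀ : ℕ, ∀ n : ℕ, n₀ ≤ n → ∀ p : ℝ,
      (n : ℝ) ^ (-(1 / twoDensity H)) ≤ p → p ≤ 1 →
      ∀ e : Sym2 (Fin n), ¬ e.IsDiag →
        gnp n p {ω |
            4 * (Nat.card H.edgeSet : ℝ) ^ 2 * (n : ℝ) ^ (Fintype.card V - 2) *
                p ^ (Nat.card H.edgeSet - 2)
              ≤ (Nat.card {A ∈ bdH (delH e (copies H n)) | A ⊆ (graphOf ω).edgeSet} : ℝ)}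
          ≤ ENNReal.ofReal ((n : ℝ) ^ (-(6 : ℝ))) := by
  classical
  obtain ⟨E, hE⟩ := (Set.toFinite H.edgeSet).exists_finset_coe
  have hEcard : Nat.card H.edgeSet = E.card := by rw [← hE]; simp
  rw [hEcard] at h2 ⊢
  obtain ⟨ε, hε, hgap⟩ := hbal.exists_gap
  obtain ⟨n₀, hn₀⟩ := exists_polylog_le_rpow E.card (Fintype.card V) hε
  refine ⟨n₀, fun n hn p hp hp1 e _ => ?_⟩
  obtain ⟨hn1, hpoly⟩ := hn₀ n hn
  have hnpos : (0 : ℝ) < n := by exact_mod_cast hn1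
  have hp0 : 0 < p := lt_of_lt_of_le (by positivity) hp
  set k := ⌈24 * Real.log n⌉₊ with hk
  set N : ℝ := (n : ℝ) ^ (Fintype.card V - 2) * p ^ (E.card - 2) with hN
  have hN0 : 0 < N := by positivity
  have hE0 : (0 : ℝ) < E.card := by exact_mod_cast (by omega : 0 < E.card)
  have hdiag : ∀ x ∈ E, ¬ x.IsDiag := fun x hx =>
    H.not_isDiag_of_mem_edgeSet (hE ▸ Finset.mem_coe.2 hx)
  have hDcard : ∀ q ∈ E.offDiag, ((E.erase q.1).erase q.2).card = E.card - 2 := by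
    intro q hq
    obtain ⟨h1, h2, h12⟩ := Finset.mem_offDiag.1 hq
    rw [Finset.card_erase_of_mem (Finset.mem_erase.2 ⟨h12.symm, h2⟩), Finset.card_erase_of_mem h1]
    omega
  have hpair : ∀ q ∈ E.offDiag, ∀ U : Finset (Sym2 (Fin n)), U.card ≤ k * E.card →
      ∑ φ ∈ Finset.univ.filter (fun φ : V ↪ Fin n => Sym2.map φ q.1 = e),
        p ^ (((E.erase q.1).erase q.2).image (Sym2.map φ) \ U).card ≤ 3 * N := by
    intro q hq U hU
    obtain ⟨hq1, hq2, hq12⟩ := Finset.mem_offDiag.1 hq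
    have hmain := sum_pow_card_sdiff_le_s8 hn1 hp ((E.erase q.1).erase q.2) q.1 (hdiag _ hq1)
      (ε := ε) (fun S hS hne => ?_) e U
    rotate_left
    · have hnot : q.1 ∉ S := fun h => by simpa using hS h
      have hsub : insert q.1 S ⊆ E := Finset.insert_subset hq1
        (hS.trans ((Finset.erase_subset _ _).trans (Finset.erase_subset _ _)))
      have hq2S : q.2 ∉ insert q.1 S := by
        rw [Finset.mem_insert, not_or]
        exact ⟨hq12.symm, fun h => by simpa using hS h⟩
      have hss : ((insert q.1 S : Finset (Sym2 V)) : Set (Sym2 V)) ⊂ H.edgeSet := by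
        rw [← hE, Finset.coe_ssubset]
        exact Finset.ssubset_iff_subset_ne.2 ⟨hsub, fun h => hq2S (h ▸ hq2)⟩
      have hcard : (insert q.1 S).card = S.card + 1 := Finset.card_insert_of_notMem hnot
      have h2le : 2 ≤ (insert q.1 S).card := by
        have := hne.card_pos
        omega
      refine ⟨(two_lt_card_endpoints (fun x hx => hdiag x (hsub hx)) h2le).le, ?_⟩
      have := hgap _ hss h2le
      rw [hcard] at this
      simpa using this
    · rw [hDcard q hq] at hmain
      refine hmain.trans ?_
      have hsmall : (2 : ℝ) ^ (E.card - 2) * (2 * (U.card : ℝ) + 2) ^ Fintype.card V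
          ≤ (n : ℝ) ^ ε := by
        refine le_trans ?_ hpoly
        have hU' : (U.card : ℝ) ≤ ((k * E.card : ℕ) : ℝ) := by exact_mod_cast hU
        gcongr
        · norm_num
        · omega
      calc _ ≤ N * (2 + (n : ℝ) ^ ε * (n : ℝ) ^ (-ε)) := by gcongr
        _ = 3 * N := by
          rw [← Real.rpow_add hnpos, add_neg_cancel, Real.rpow_zero]
          ring
  set I := E.offDiag.sigma fun q =>
    (Finset.univ : Finset (V ↪ Fin n)).filter fun φ : V ↪ Fin n => Sym2.map φ q.1 = e with hI
  set A := fun i : (_ : Sym2 V × Sym2 V) × (V ↪ Fin n) =>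
    ((E.erase i.1.1).erase i.1.2).image (Sym2.map i.2) with hA
  have hsum : ∀ U : Finset (Sym2 (Fin n)), U.card ≤ k * E.card →
      ∑ i ∈ I, p ^ (A i \ U).card ≤ 3 * (E.card : ℝ) ^ 2 * N := by
    intro U hU
    rw [hI, Finset.sum_sigma]
    calc _ ≤ ∑ _q ∈ E.offDiag, 3 * N := Finset.sum_le_sum fun q hq => hpair q hq U hU
      _ = E.offDiag.card * (3 * N) := by rw [Finset.sum_const, nsmul_eq_mul]
      _ ≤ (E.card : ℝ) ^ 2 * (3 * N) := by
          gcongr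
          rw [Finset.offDiag_card, sq]
          exact_mod_cast Nat.sub_le _ _
      _ = _ := by ring
  have hAcard : ∀ i ∈ I, (A i).card ≤ E.card := fun i _ =>
    Finset.card_image_le.trans (Finset.card_le_card
      ((Finset.erase_subset _ _).trans (Finset.erase_subset _ _)))
  calc _ ≤ gnp n p {ω | 4 * (E.card : ℝ) ^ 2 * N ≤ ∑ i ∈ I, presence (A i) ω} := by
        refine measure_mono fun ω hω => ?_
        refine le_trans (le_of_eq ?_) (le_trans hω (card_bdH_delH_copies_le H E hE e ω))
        rw [hN]
        ring
    _ ≤ ENNReal.ofReal ((3 * (E.card : ℝ) ^ 2 * N / (4 * (E.card : ℝ) ^ 2 * N)) ^ k) :=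
        gnp_sum_presence_ge_le n hp0.le hp1 I A E.card k _ _ (by positivity) hAcard hsum
    _ = ENNReal.ofReal ((3 / 4) ^ k) := by
        congr 2
        field_simp
    _ ≤ _ := ENNReal.ofReal_le_ofReal (three_quarters_pow_ceil_log_le hn1)
end
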